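/- arXiv:1706.05738 — 6 statements merged into one kernel-verified Lean document; each statement's English description precedes it below -/
import Mathlib

section
/- There is an absolute constant C > 0 such that for every integer M ≥ 1, reals ε, b ∈ (0,1], and subset S ⊆ {0,...,M-1}, there exist an integer m ≤ C·(√b/ε² + |S|/(M·ε²) + √M) and a randomized algorithm which draws at most 2m i.i.d. samples from an unknown probability distribution Q on {0,...,M-1} and outputs either 'reject' or a vector (Ĥ'(ξ))_{ξ∈S} of complex numbers, such that with probability at least 7/10 all of the following hold simultaneously: (1) if ‖Q‖₂² > 2b, the output is reject; (2) if ‖Q‖₂² ≤ 2b and every function Q* : {0,...,M-1} → ℝ whose DFT modulo M vanishes outside S satisfies ‖Q − Q*‖₂ > ε, the output is reject; (3) if ‖Q‖₂² ≤ b and there exists a function Q* : {0,...,M-1} → ℝ whose DFT modulo M vanishes outside S with ‖Q − Q*‖₂ ≤ ε/2, the output is not reject; (4) if the output is not reject, then ‖Q̂·1_S − Ĥ'‖₂ ≤ ε·√M/10 and the inverse DFT modulo M of Ĥ' (extended by zero outside S), call it H', satisfies ‖Q − H'‖₂ ≤ 6ε/5. -/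
open scoped BigOperators

namespace Stmt4

open Classical in
/-- Indicator of a proposition, as a real number. -/
noncomputable def ind (p : Prop) : ℝ := if p then 1 else 0

/-- The discrete Fourier transform modulo `M` of `F : {0,…,M-1} → ℂ`. -/
noncomputable def dft (M : ℕ) (F : Fin M → ℂ) (ξ : Fin M) : ℂ :=
  ∑ j : Fin M, F j *
    Complex.exp (-(2 * (Real.pi : ℂ) * Complex.I * ((ξ : ℕ) : ℂ) * ((j : ℕ) : ℂ)) / (M : ℂ))

/-- The inverse discrete Fourier transform modulo `M` of `G : {0,…,M-1} → ℂ`. -/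
noncomputable def idft (M : ℕ) (G : Fin M → ℂ) (j : Fin M) : ℂ :=
  (1 / (M : ℂ)) * ∑ ξ : Fin M, G ξ *
    Complex.exp ((2 * (Real.pi : ℂ) * Complex.I * ((ξ : ℕ) : ℂ) * ((j : ℕ) : ℂ)) / (M : ℂ))

/-- Restriction of `F` to the set `S` (zero outside `S`). -/
def restrict {M : ℕ} (S : Finset (Fin M)) (F : Fin M → ℂ) : Fin M → ℂ :=
  fun ξ => if ξ ∈ S then F ξ else 0

/-- The `L₂` norm of a function on `{0,…,M-1}`. -/
noncomputable def l2norm {M : ℕ} (F : Fin M → ℂ) : ℝ :=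
  Real.sqrt (∑ j, ‖F j‖ ^ 2)

/-- The guarantees ("all the following statements hold simultaneously") required of the
output `out` of the Fourier-sparsity tester, for the unknown distribution `Q`:
(1) if `‖Q‖₂² > 2b` it rejects; (2) if `‖Q‖₂² ≤ 2b` and every `Q*` with DFT supported on `S`
is `ε`-far from `Q` in `L₂`, it rejects; (3) if `‖Q‖₂² ≤ b` and some `Q*` with DFT supported
on `S` is `(ε/2)`-close to `Q` in `L₂`, it does not reject; (4) if it does not reject,
the output Fourier coefficients are `(ε√M/10)`-close to `Q̂·1_S` and their inverse DFT `H'`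
satisfies `‖Q - H'‖₂ ≤ 6ε/5`. -/
def GoodOutcome (M : ℕ) (S : Finset (Fin M)) (ε b : ℝ) (Q : Fin M → ℝ)
    (out : Option (Fin M → ℂ)) : Prop :=
  ((2 * b < ∑ j, Q j ^ 2) → out = none) ∧
  (((∑ j, Q j ^ 2 ≤ 2 * b) ∧
      ∀ Qstar : Fin M → ℝ, (∀ ξ ∉ S, dft M (fun j => (Qstar j : ℂ)) ξ = 0) →
        ε < Real.sqrt (∑ j, (Q j - Qstar j) ^ 2)) → out = none) ∧
  (((∑ j, Q j ^ 2 ≤ b) ∧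
      ∃ Qstar : Fin M → ℝ, (∀ ξ ∉ S, dft M (fun j => (Qstar j : ℂ)) ξ = 0) ∧
        Real.sqrt (∑ j, (Q j - Qstar j) ^ 2) ≤ ε / 2) → out ≠ none) ∧
  (∀ g : Fin M → ℂ, out = some g →
      l2norm (fun ξ => restrict S (dft M (fun j => (Q j : ℂ))) ξ - restrict S g ξ) ≤
        ε * Real.sqrt M / 10 ∧
      l2norm (fun j => (Q j : ℂ) - idft M (restrict S g) j) ≤ 6 * ε / 5)

section IidMean

variable {ι α : Type*} [Fintype ι] [DecidableEq ι] [Fintype α]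

/-- The expectation of `F` on samples `x : ι → α` drawn i.i.d. from `Q`. -/
noncomputable def iidMean (Q : α → ℝ) (F : (ι → α) → ℝ) : ℝ :=
  ∑ x, (∏ i, Q (x i)) * F x

theorem iidMean_add (Q : α → ℝ) (F G : (ι → α) → ℝ) :
    iidMean Q (fun x => F x + G x) = iidMean Q F + iidMean Q G := by
  simp only [iidMean, mul_add, Finset.sum_add_distrib]

theorem iidMean_const_mul (Q : α → ℝ) (c : ℝ) (F : (ι → α) → ℝ) :
    iidMean Q (fun x => c * F x) = c * iidMean Q F := by
  simp only [iidMean, Finset.mul_sum, mul_left_comm]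

theorem iidMean_sum {κ : Type*} (Q : α → ℝ) (s : Finset κ) (F : κ → (ι → α) → ℝ) :
    iidMean Q (fun x => ∑ k ∈ s, F k x) = ∑ k ∈ s, iidMean Q (F k) := by
  simp only [iidMean, Finset.mul_sum]
  exact Finset.sum_comm

theorem iidMean_mono {Q : α → ℝ} (hQ : ∀ a, 0 ≤ Q a) {F G : (ι → α) → ℝ}
    (h : ∀ x, F x ≤ G x) : iidMean Q F ≤ iidMean Q G :=
  Finset.sum_le_sum fun x _ =>
    mul_le_mul_of_nonneg_left (h x) (Finset.prod_nonneg fun i _ => hQ (x i))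

theorem iidMean_const {Q : α → ℝ} (hQ : ∑ a, Q a = 1) (c : ℝ) :
    iidMean Q (fun _ : ι → α => c) = c := by
  have h := (Finset.prod_univ_sum (fun _ : ι => (Finset.univ : Finset α)) (fun _ a => Q a)).symm
  rw [Fintype.piFinset_univ] at h
  simp only [iidMean, ← Finset.sum_mul, h, hQ, Finset.prod_const_one, one_mul]

/-- Redrawing one of the samples does not change the expectation. -/
theorem iidMean_resample {Q : α → ℝ} (hQ : ∑ a, Q a = 1) (i : ι) (F : (ι → α) → ℝ) :
    iidMean Q F = iidMean Q (fun x => ∑ a, Q a * F (Function.update x i a)) := by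
  have hinv : Function.Involutive
      (fun y : (ι → α) × α => (Function.update y.1 i y.2, y.1 i)) := by
    intro y
    simp
  have hw : ∀ y : (ι → α) × α,
      (∏ k, Q (Function.update y.1 i y.2 k)) * Q (y.1 i) = (∏ k, Q (y.1 k)) * Q y.2 := by
    intro y
    rw [← Finset.mul_prod_erase Finset.univ _ (Finset.mem_univ i),
      ← Finset.mul_prod_erase Finset.univ (fun k => Q (y.1 k)) (Finset.mem_univ i)]
    rw [Finset.prod_congr rfl (g := fun k => Q (y.1 k))]
    · simp only [Function.update_self]
      ring
    · intro k hk
      rw [Function.update_of_ne (Finset.ne_of_mem_erase hk)]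
  calc iidMean Q F = ∑ y : (ι → α) × α, ((∏ k, Q (y.1 k)) * Q y.2) * F y.1 := by
        rw [Fintype.sum_prod_type]
        refine Finset.sum_congr rfl fun x _ => ?_
        simp only [← Finset.sum_mul, ← Finset.mul_sum, hQ, mul_one]
    _ = ∑ y : (ι → α) × α, ((∏ k, Q (y.1 k)) * Q y.2) * F (Function.update y.1 i y.2) := by
        rw [← Equiv.sum_comp hinv.toPerm]
        refine Finset.sum_congr rfl fun y _ => ?_
        simp only [Function.Involutive.coe_toPerm, hw]
    _ = _ := by
        rw [Fintype.sum_prod_type]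
        simp only [iidMean, Finset.mul_sum, mul_assoc]

theorem iidMean_eval {Q : α → ℝ} (hQ : ∑ a, Q a = 1) (i : ι) (f : α → ℝ) :
    iidMean Q (fun x : ι → α => f (x i)) = ∑ a, Q a * f a := by
  rw [iidMean_resample hQ i]
  simp only [Function.update_self]
  exact iidMean_const hQ _

theorem iidMean_eval₂ {Q : α → ℝ} (hQ : ∑ a, Q a = 1) {i j : ι} (hij : i ≠ j)
    (f : α → α → ℝ) :
    iidMean Q (fun x : ι → α => f (x i) (x j)) = ∑ a, Q a * ∑ b, Q b * f b a := by
  rw [iidMean_resample hQ i]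
  simp only [Function.update_self, Function.update_of_ne hij.symm]
  exact iidMean_eval hQ j fun a => ∑ b, Q b * f b a

theorem iidMean_sq_sum_of_orthogonal {κ : Type*} [Fintype κ] (Q : α → ℝ)
    (G : κ → (ι → α) → ℝ)
    (h : ∀ p q, p ≠ q → iidMean Q (fun x => G p x * G q x) = 0) :
    iidMean Q (fun x => (∑ p, G p x) ^ 2) = ∑ p, iidMean Q (fun x => G p x ^ 2) := by
  simp only [sq, Finset.sum_mul_sum, iidMean_sum]
  refine Finset.sum_congr rfl fun p _ => ?_
  exact Finset.sum_eq_single p (fun q _ hq => h p q hq.symm) (by simp)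

theorem iidMean_sq_sum {κ : Type*} [Fintype κ] {Q : α → ℝ} (hQ : ∑ a, Q a = 1)
    {u : κ → ι} (hu : Function.Injective u) {f : α → ℝ} (hf : ∑ a, Q a * f a = 0) :
    iidMean Q (fun x => (∑ i, f (x (u i))) ^ 2) = Fintype.card κ * ∑ a, Q a * f a ^ 2 := by
  rw [iidMean_sq_sum_of_orthogonal]
  · simp only [iidMean_eval hQ _ (fun a => f a ^ 2), Finset.sum_const, Finset.card_univ,
      nsmul_eq_mul]
  · intro p q hpq
    rw [iidMean_eval₂ hQ (hu.ne hpq) (fun a b => f a * f b)]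
    simp only [← mul_assoc, ← Finset.sum_mul, hf, zero_mul, mul_zero, Finset.sum_const_zero]

theorem iidMean_sq_sum₂ {κ : Type*} [Fintype κ] {Q : α → ℝ} (hQ : ∑ a, Q a = 1)
    {u v : κ → ι} (hu : Function.Injective u) (hv : Function.Injective v)
    (huv : ∀ i j, u i ≠ v j) {k : α → α → ℝ} (hl : ∀ b, ∑ a, Q a * k a b = 0)
    (hr : ∀ a, ∑ b, Q b * k a b = 0) :
    iidMean Q (fun x => (∑ i, ∑ j, k (x (u i)) (x (v j))) ^ 2) =
      (Fintype.card κ : ℝ) ^ 2 * ∑ a, Q a * ∑ b, Q b * k b a ^ 2 := by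
  have h := iidMean_sq_sum_of_orthogonal (ι := ι) Q
    (fun (p : κ × κ) x => k (x (u p.1)) (x (v p.2))) ?_
  · simp only [Fintype.sum_prod_type] at h
    rw [h]
    simp only [iidMean_eval₂ hQ (huv _ _) (fun a b => k a b ^ 2), Finset.sum_const,
      Finset.card_univ, nsmul_eq_mul]
    ring
  · rintro ⟨i, j⟩ ⟨i', j'⟩ hne
    by_cases hi : i = i'
    · have hj : j ≠ j' := fun hj => hne (by rw [hi, hj])
      rw [iidMean_resample hQ (v j)]
      simp only [Function.update_self, Function.update_of_ne (huv _ _),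
        Function.update_of_ne (hv.ne hj).symm, ← mul_assoc, ← Finset.sum_mul, hr, zero_mul]
      exact iidMean_const hQ 0
    · rw [iidMean_resample hQ (u i)]
      simp only [Function.update_self, Function.update_of_ne (huv _ _).symm,
        Function.update_of_ne (hu.ne hi).symm, ← mul_assoc, ← Finset.sum_mul, hl, zero_mul]
      exact iidMean_const hQ 0

theorem sum_mul_sq_sub_mean_le {Q : α → ℝ} (hQ : ∑ a, Q a = 1) (f : α → ℝ) :
    ∑ a, Q a * (f a - ∑ b, Q b * f b) ^ 2 ≤ ∑ a, Q a * f a ^ 2 := by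
  set c := ∑ b, Q b * f b with hc
  have h : ∑ a, Q a * (f a - c) ^ 2 = ∑ a, Q a * f a ^ 2 - c ^ 2 := by
    calc ∑ a, Q a * (f a - c) ^ 2
        = ∑ a, (Q a * f a ^ 2 - 2 * c * (Q a * f a) + c ^ 2 * Q a) :=
          Finset.sum_congr rfl fun a _ => by ring
      _ = _ := by
          rw [Finset.sum_add_distrib, Finset.sum_sub_distrib, ← Finset.mul_sum,
            ← Finset.mul_sum, hQ, ← hc]
          ring
  nlinarith [sq_nonneg c]

theorem iidMean_sq_mean_sub_le {m : ℕ} (hm : 0 < m) {Q : α → ℝ} (hQ : ∑ a, Q a = 1)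
    {u : Fin m → ι} (hu : Function.Injective u) (f : α → ℝ) :
    iidMean Q (fun x => ((∑ i, f (x (u i))) / m - ∑ a, Q a * f a) ^ 2) ≤
      (∑ a, Q a * f a ^ 2) / m := by
  set c := ∑ b, Q b * f b with hc
  have hm' : (m : ℝ) ≠ 0 := by positivity
  have hz : ∑ a, Q a * (f a - c) = 0 := by
    simp only [mul_sub, Finset.sum_sub_distrib, ← Finset.sum_mul, hQ, ← hc]
    ring
  have hE : iidMean Q (fun x : ι → α => ((∑ i, f (x (u i))) / m - c) ^ 2) =
      iidMean Q (fun x : ι → α => (1 / (m : ℝ) ^ 2) * (∑ i, (f (x (u i)) - c)) ^ 2) := by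
    congr 1
    funext x
    rw [Finset.sum_sub_distrib, Finset.sum_const, Finset.card_univ, Fintype.card_fin,
      nsmul_eq_mul]
    field_simp
  rw [hE, iidMean_const_mul, iidMean_sq_sum hQ hu hz, Fintype.card_fin]
  calc 1 / (m : ℝ) ^ 2 * (m * ∑ a, Q a * (f a - c) ^ 2)
      = (∑ a, Q a * (f a - c) ^ 2) / m := by field_simp
    _ ≤ _ := div_le_div_of_nonneg_right (sum_mul_sq_sub_mean_le hQ f) (by positivity)

theorem iidMean_norm_sq_mean_sub_le {m : ℕ} (hm : 0 < m) {Q : α → ℝ} (hQ0 : ∀ a, 0 ≤ Q a)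
    (hQ : ∑ a, Q a = 1) {u : Fin m → ι} (hu : Function.Injective u) (f : α → ℂ)
    (hf : ∀ a, ‖f a‖ ≤ 1) :
    iidMean Q (fun x => ‖∑ a, (Q a : ℂ) * f a - (∑ i, f (x (u i))) / m‖ ^ 2) ≤ 1 / m := by
  have hsplit : ∀ x : ι → α, ‖∑ a, (Q a : ℂ) * f a - (∑ i, f (x (u i))) / m‖ ^ 2 =
      ((∑ i, (f (x (u i))).re) / m - ∑ a, Q a * (f a).re) ^ 2 +
      ((∑ i, (f (x (u i))).im) / m - ∑ a, Q a * (f a).im) ^ 2 := by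
    intro x
    rw [Complex.sq_norm, Complex.normSq_apply]
    simp only [Complex.sub_re, Complex.sub_im, Complex.re_sum, Complex.im_sum,
      Complex.re_ofReal_mul, Complex.im_ofReal_mul, Complex.div_natCast_re,
      Complex.div_natCast_im]
    ring
  simp only [hsplit]
  rw [iidMean_add]
  calc _ ≤ (∑ a, Q a * (f a).re ^ 2) / m + (∑ a, Q a * (f a).im ^ 2) / m :=
        add_le_add (iidMean_sq_mean_sub_le hm hQ hu fun a => (f a).re)
          (iidMean_sq_mean_sub_le hm hQ hu fun a => (f a).im)
    _ = (∑ a, Q a * ‖f a‖ ^ 2) / m := by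
        rw [← add_div, ← Finset.sum_add_distrib]
        congr 1
        refine Finset.sum_congr rfl fun a _ => ?_
        rw [Complex.sq_norm, Complex.normSq_apply]
        ring
    _ ≤ 1 / m := by
        gcongr
        rw [← hQ]
        refine Finset.sum_le_sum fun a _ => mul_le_of_le_one_right (hQ0 a) ?_
        exact pow_le_one₀ (norm_nonneg _) (hf a)

/-- The two-sample estimator of the quadratic form `∑ a b, Q a * K a b * Q b`. -/
noncomputable def crossEstimate {m : ℕ} (u v : Fin m → ι) (K : α → α → ℝ) (x : ι → α) : ℝ :=
  (∑ i, ∑ j, K (x (u i)) (x (v j))) / (m : ℝ) ^ 2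

theorem iidMean_sq_degenerate_le {m : ℕ} (hm : 0 < m) {Q : α → ℝ} (hQ0 : ∀ a, 0 ≤ Q a)
    (hQ : ∑ a, Q a = 1) {u v : Fin m → ι} (hu : Function.Injective u)
    (hv : Function.Injective v) (huv : ∀ i j, u i ≠ v j) {K : α → α → ℝ}
    (hK : ∀ a b, K a b = K b a) {h : α → ℝ} (hh : ∀ a, h a = ∑ b, Q b * K b a) :
    iidMean Q (fun x => crossEstimate u v
        (fun a b => K a b - h a - h b + ∑ c, Q c * h c) x ^ 2) ≤
      (∑ a, Q a * ∑ b, Q b * K b a ^ 2) / (m : ℝ) ^ 2 := by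
  set τ := ∑ c, Q c * h c with hτ
  have hl : ∀ b, ∑ a, Q a * (K a b - h a - h b + τ) = 0 := by
    intro b
    simp only [mul_sub, mul_add, Finset.sum_sub_distrib, Finset.sum_add_distrib,
      ← Finset.sum_mul, hQ, ← hτ, ← hh]
    ring
  have hr : ∀ a, ∑ b, Q b * (K a b - h a - h b + τ) = 0 := by
    intro a
    rw [← hl a]
    refine Finset.sum_congr rfl fun b _ => ?_
    rw [hK a b]
    ring
  have hm' : (m : ℝ) ≠ 0 := by positivity
  simp only [crossEstimate, div_pow, div_eq_inv_mul _ (((m : ℝ) ^ 2) ^ 2)]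
  rw [iidMean_const_mul, iidMean_sq_sum₂ hQ hu hv huv hl hr, Fintype.card_fin]
  have hvar : ∑ a, Q a * ∑ b, Q b * (K b a - h b - h a + τ) ^ 2 ≤
      ∑ a, Q a * ∑ b, Q b * K b a ^ 2 := by
    calc ∑ a, Q a * ∑ b, Q b * (K b a - h b - h a + τ) ^ 2
        ≤ ∑ a, Q a * ∑ b, Q b * (K b a - h b) ^ 2 := by
          refine Finset.sum_le_sum fun a _ => mul_le_mul_of_nonneg_left ?_ (hQ0 a)
          have := sum_mul_sq_sub_mean_le hQ fun b => K b a - h b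
          simp only [mul_sub, Finset.sum_sub_distrib, ← hτ, ← hh] at this
          simpa only [mul_sub, Finset.sum_sub_distrib, sub_sub_eq_add_sub, sub_add_eq_add_sub,
            sub_sub, add_comm, add_left_comm] using this
      _ = ∑ b, Q b * ∑ a, Q a * (K a b - h b) ^ 2 := by
          simp only [Finset.mul_sum]
          rw [Finset.sum_comm]
          refine Finset.sum_congr rfl fun b _ => Finset.sum_congr rfl fun a _ => ?_
          rw [hK b a]
          ring
      _ ≤ _ := by
          refine Finset.sum_le_sum fun b _ => mul_le_mul_of_nonneg_left ?_ (hQ0 b)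
          rw [hh b]
          exact sum_mul_sq_sub_mean_le hQ fun a => K a b
  calc (((m : ℝ) ^ 2) ^ 2)⁻¹ *
        ((m : ℝ) ^ 2 * ∑ a, Q a * ∑ b, Q b * (K b a - h b - h a + τ) ^ 2)
      = (∑ a, Q a * ∑ b, Q b * (K b a - h b - h a + τ) ^ 2) / (m : ℝ) ^ 2 := by field_simp
    _ ≤ _ := by gcongr

theorem crossEstimate_sub_eq {κ β : Type*} {m : ℕ} (hm : 0 < m) (u v : Fin m → κ)
    (K : β → β → ℝ) (h : β → ℝ) (τ : ℝ) (x : κ → β) :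
    crossEstimate u v K x - τ =
      ((∑ i, h (x (u i))) / m - τ) + ((∑ j, h (x (v j))) / m - τ) +
        crossEstimate u v (fun a b => K a b - h a - h b + τ) x := by
  have hm' : (m : ℝ) ≠ 0 := by positivity
  simp only [crossEstimate, Finset.sum_add_distrib, Finset.sum_sub_distrib, Finset.sum_const,
    Finset.card_univ, Fintype.card_fin, nsmul_eq_mul, ← Finset.mul_sum]
  field_simp
  ring

theorem projection_diag_eq {K : α → α → ℝ} (hK : ∀ a b, K a b = K b a)
    (hKK : ∀ a c, ∑ b, K a b * K b c = K a c) (a : α) : ∑ b, K b a ^ 2 = K a a := by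
  rw [← hKK a a]
  exact Finset.sum_congr rfl fun b _ => by rw [hK a b, sq]

theorem projection_diag_le_one {K : α → α → ℝ} (hK : ∀ a b, K a b = K b a)
    (hKK : ∀ a c, ∑ b, K a b * K b c = K a c) (a : α) : K a a ≤ 1 := by
  have h := Finset.single_le_sum (f := fun b => K b a ^ 2) (fun b _ => sq_nonneg _)
    (Finset.mem_univ a)
  rw [projection_diag_eq hK hKK] at h
  nlinarith

theorem sum_mul_sum_mul_projection_sq_le {Q : α → ℝ} {K : α → α → ℝ}
    (hK : ∀ a b, K a b = K b a) (hKK : ∀ a c, ∑ b, K a b * K b c = K a c) :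
    ∑ a, Q a * ∑ b, Q b * K b a ^ 2 ≤ ∑ a, Q a ^ 2 := by
  have h1 : ∑ a, ∑ b, Q a ^ 2 * K b a ^ 2 ≤ ∑ a, Q a ^ 2 := by
    refine Finset.sum_le_sum fun a _ => ?_
    rw [← Finset.mul_sum, projection_diag_eq hK hKK]
    exact mul_le_of_le_one_right (sq_nonneg _) (projection_diag_le_one hK hKK a)
  have h2 : ∑ a, ∑ b, Q b ^ 2 * K b a ^ 2 = ∑ a, ∑ b, Q a ^ 2 * K b a ^ 2 := by
    rw [Finset.sum_comm]
    exact Finset.sum_congr rfl fun b _ => Finset.sum_congr rfl fun a _ => by rw [hK b a]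
  have h3 : 2 * ∑ a, Q a * ∑ b, Q b * K b a ^ 2 ≤
      ∑ a, ∑ b, Q a ^ 2 * K b a ^ 2 + ∑ a, ∑ b, Q b ^ 2 * K b a ^ 2 := by
    simp only [Finset.mul_sum, ← Finset.sum_add_distrib]
    refine Finset.sum_le_sum fun a _ => Finset.sum_le_sum fun b _ => ?_
    nlinarith [mul_nonneg (sq_nonneg (Q a - Q b)) (sq_nonneg (K b a))]
  linarith

theorem sum_mul_sq_le_sqrt_mul (Q h : α → ℝ) :
    ∑ a, Q a * h a ^ 2 ≤ √(∑ a, Q a ^ 2) * ∑ a, h a ^ 2 := by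
  rw [Finset.mul_sum]
  refine Finset.sum_le_sum fun a _ => mul_le_mul_of_nonneg_right ?_ (sq_nonneg _)
  refine Real.le_sqrt_of_sq_le ?_
  exact Finset.single_le_sum (f := fun a => Q a ^ 2) (fun b _ => sq_nonneg _)
    (Finset.mem_univ a)

theorem iidMean_sq_crossEstimate_sub_le {m : ℕ} (hm : 0 < m) {Q : α → ℝ}
    (hQ0 : ∀ a, 0 ≤ Q a) (hQ : ∑ a, Q a = 1) {u v : Fin m → ι} (hu : Function.Injective u)
    (hv : Function.Injective v) (huv : ∀ i j, u i ≠ v j) {K : α → α → ℝ}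
    (hK : ∀ a b, K a b = K b a) (hKK : ∀ a c, ∑ b, K a b * K b c = K a c)
    {h : α → ℝ} (hh : ∀ a, h a = ∑ b, Q b * K b a) :
    iidMean Q (fun x => (crossEstimate u v K x - ∑ a, h a ^ 2) ^ 2) ≤
      3 * (2 * (√(∑ a, Q a ^ 2) * ∑ a, h a ^ 2) / m + (∑ a, Q a ^ 2) / (m : ℝ) ^ 2) := by
  have hτ : ∑ a, h a ^ 2 = ∑ a, Q a * h a := by
    have hexp : ∀ a, Q a * h a = ∑ b, Q a * (h b * K b a) := by
      intro a
      rw [← Finset.mul_sum]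
      congr 1
      calc h a = ∑ c, Q c * ∑ b, K c b * K b a := by simp only [hKK, hh]
        _ = ∑ b, h b * K b a := by
          simp only [hh, Finset.mul_sum, Finset.sum_mul]
          rw [Finset.sum_comm]
          exact Finset.sum_congr rfl fun b _ => Finset.sum_congr rfl fun c _ => by ring
    simp only [hexp]
    rw [Finset.sum_comm]
    refine Finset.sum_congr rfl fun b _ => ?_
    calc h b ^ 2 = h b * ∑ a, Q a * K a b := by rw [← hh, sq]
      _ = _ := by
        rw [Finset.mul_sum]
        exact Finset.sum_congr rfl fun a _ => by rw [hK b a]; ring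
  have hlin := sum_mul_sq_le_sqrt_mul Q h
  have hU := iidMean_sq_mean_sub_le hm hQ hu h
  have hV := iidMean_sq_mean_sub_le hm hQ hv h
  have hB := iidMean_sq_degenerate_le hm hQ0 hQ hu hv huv hK hh
  have hp := sum_mul_sum_mul_projection_sq_le (Q := Q) hK hKK
  have hlin' : (∑ a, Q a * h a ^ 2) / m ≤ (√(∑ a, Q a ^ 2) * ∑ a, h a ^ 2) / m := by gcongr
  have hp' : (∑ a, Q a * ∑ b, Q b * K b a ^ 2) / (m : ℝ) ^ 2 ≤
      (∑ a, Q a ^ 2) / (m : ℝ) ^ 2 := by gcongr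
  have hmain : iidMean Q (fun x => (crossEstimate u v K x - ∑ a, h a ^ 2) ^ 2) ≤
      iidMean Q (fun x => 3 * (((∑ i, h (x (u i))) / m - ∑ a, Q a * h a) ^ 2 +
        ((∑ i, h (x (v i))) / m - ∑ a, Q a * h a) ^ 2 +
        crossEstimate u v (fun a b => K a b - h a - h b + ∑ c, Q c * h c) x ^ 2)) := by
    refine iidMean_mono hQ0 fun x => ?_
    rw [hτ, crossEstimate_sub_eq hm u v K h]
    set A := (∑ i, h (x (u i))) / m - ∑ a, Q a * h a
    set B := (∑ i, h (x (v i))) / m - ∑ a, Q a * h a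
    set D := crossEstimate u v (fun a b => K a b - h a - h b + ∑ c, Q c * h c) x
    nlinarith [sq_nonneg (A - B), sq_nonneg (A - D), sq_nonneg (B - D)]
  rw [iidMean_const_mul, iidMean_add, iidMean_add] at hmain
  have hd : 2 * (√(∑ a, Q a ^ 2) * ∑ a, h a ^ 2) / (m : ℝ) =
    2 * ((√(∑ a, Q a ^ 2) * ∑ a, h a ^ 2) / m) := by ring
  rw [hd]
  linarith

theorem iidMean_crossEstimate_deviation_le {m : ℕ} (hm : 0 < m) {Q : α → ℝ}
    (hQ0 : ∀ a, 0 ≤ Q a) (hQ : ∑ a, Q a = 1) {u v : Fin m → ι} (hu : Function.Injective u)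
    (hv : Function.Injective v) (huv : ∀ i j, u i ≠ v j) {K : α → α → ℝ}
    (hK : ∀ a b, K a b = K b a) (hKK : ∀ a c, ∑ b, K a b * K b c = K a c)
    {h : α → ℝ} (hh : ∀ a, h a = ∑ b, Q b * K b a) {t : ℝ} (ht : 0 < t)
    (hτt : ∑ a, h a ^ 2 ≤ t) (hsize : √(∑ a, Q a ^ 2) ≤ t * m / 1000) :
    iidMean Q (fun x => 16 / t ^ 2 * (crossEstimate u v K x - ∑ a, h a ^ 2) ^ 2) ≤ 1 / 10 := by
  rw [iidMean_const_mul]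
  have hE := iidMean_sq_crossEstimate_sub_le hm hQ0 hQ hu hv huv hK hKK hh
  have hm' : (0 : ℝ) < m := by positivity
  set p := ∑ a, Q a ^ 2 with hp
  have hp0 : 0 ≤ p := Finset.sum_nonneg fun a _ => sq_nonneg _
  have hs0 := Real.sqrt_nonneg p
  have h1 : (√p * ∑ a, h a ^ 2) / m ≤ t ^ 2 / 1000 := by
    rw [div_le_iff₀ hm']
    calc √p * ∑ a, h a ^ 2 ≤ √p * t := by gcongr
      _ ≤ (t * m / 1000) * t := by gcongr
      _ = _ := by ring
  have h2 : p / (m : ℝ) ^ 2 ≤ t ^ 2 / 1000 ^ 2 := by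
    rw [div_le_iff₀ (by positivity), ← Real.sq_sqrt hp0]
    calc √p ^ 2 ≤ (t * m / 1000) ^ 2 := by gcongr
      _ = _ := by ring
  rw [mul_div_assoc] at hE
  rw [div_mul_eq_mul_div, div_le_iff₀ (by positivity)]
  nlinarith [sq_nonneg t]

end IidMean

section Fourier

theorem sum_exp_mul_conj_exp {M : ℕ} (j k : Fin M) :
    ∑ ξ : Fin M, Complex.exp (2 * (Real.pi : ℂ) * Complex.I * ((ξ : ℕ) : ℂ) * ((j : ℕ) : ℂ) / M) *
      Complex.exp (-(2 * (Real.pi : ℂ) * Complex.I * ((ξ : ℕ) : ℂ) * ((k : ℕ) : ℂ)) / M) =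
      if j = k then (M : ℂ) else 0 := by
  have hM : M ≠ 0 := fun h => by subst h; exact j.elim0
  have hM' : (M : ℂ) ≠ 0 := by exact_mod_cast hM
  have hζ := Complex.isPrimitiveRoot_exp M hM
  set ζ := Complex.exp (2 * Real.pi * Complex.I / M) with hζdef
  have hζ0 : ζ ≠ 0 := Complex.exp_ne_zero _
  set z := ζ ^ (j : ℕ) / ζ ^ (k : ℕ) with hz
  have hterm : ∀ ξ : Fin M,
      Complex.exp (2 * (Real.pi : ℂ) * Complex.I * ((ξ : ℕ) : ℂ) * ((j : ℕ) : ℂ) / M) *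
      Complex.exp (-(2 * (Real.pi : ℂ) * Complex.I * ((ξ : ℕ) : ℂ) * ((k : ℕ) : ℂ)) / M) =
      z ^ (ξ : ℕ) := by
    intro ξ
    rw [hz, hζdef, ← Complex.exp_nat_mul, ← Complex.exp_nat_mul, ← Complex.exp_sub,
      ← Complex.exp_nat_mul, ← Complex.exp_add]
    congr 1
    field_simp
    ring
  simp only [hterm]
  rw [Fin.sum_univ_eq_sum_range (fun n => z ^ n)]
  split_ifs with hjk
  · have : z = 1 := by rw [hz, hjk, div_self (pow_ne_zero _ hζ0)]
    simp [this]
  · have hz1 : z ≠ 1 := by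
      intro h
      rw [hz, div_eq_one_iff_eq (pow_ne_zero _ hζ0)] at h
      exact hjk (Fin.ext (hζ.pow_inj j.2 k.2 h))
    have hzM : z ^ M = 1 := by
      rw [hz, div_pow, ← pow_mul, ← pow_mul, mul_comm, mul_comm (k : ℕ), pow_mul, pow_mul,
        hζ.pow_eq_one, one_pow, one_pow, div_one]
    rw [geom_sum_eq hz1, hzM, sub_self, zero_div]

theorem sum_norm_sq_dft (M : ℕ) (F : Fin M → ℂ) :
    ∑ ξ, ‖dft M F ξ‖ ^ 2 = M * ∑ j, ‖F j‖ ^ 2 := by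
  have hconj : ∀ ξ j : Fin M, (starRingEnd ℂ)
      (Complex.exp (-(2 * (Real.pi : ℂ) * Complex.I * ((ξ : ℕ) : ℂ) * ((j : ℕ) : ℂ)) / M)) =
      Complex.exp (2 * (Real.pi : ℂ) * Complex.I * ((ξ : ℕ) : ℂ) * ((j : ℕ) : ℂ) / M) := by
    intro ξ j
    rw [← Complex.exp_conj]
    congr 1
    simp [map_ofNat]
  have h : ((∑ ξ, ‖dft M F ξ‖ ^ 2 : ℝ) : ℂ) = ((M * ∑ j, ‖F j‖ ^ 2 : ℝ) : ℂ) := by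
    push_cast
    simp only [← Complex.conj_mul', dft, map_sum, map_mul, hconj, Finset.sum_mul_sum]
    rw [Finset.sum_comm, Finset.mul_sum]
    refine Finset.sum_congr rfl fun j _ => ?_
    rw [Finset.sum_comm]
    calc _ = ∑ k, (starRingEnd ℂ) (F j) * F k * (if j = k then (M : ℂ) else 0) := by
          refine Finset.sum_congr rfl fun k _ => ?_
          rw [← sum_exp_mul_conj_exp j k, Finset.mul_sum]
          exact Finset.sum_congr rfl fun ξ _ => by ring
      _ = _ := by
          simp only [mul_ite, mul_zero, Finset.sum_ite_eq, Finset.mem_univ, if_true]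
          ring
  exact_mod_cast h

theorem dft_idft {M : ℕ} (G : Fin M → ℂ) : dft M (idft M G) = G := by
  funext η
  have hM : (M : ℂ) ≠ 0 := by exact_mod_cast (fun h => by subst h; exact η.elim0 : M ≠ 0)
  simp only [dft, idft, Finset.mul_sum, Finset.sum_mul]
  rw [Finset.sum_comm]
  calc _ = ∑ ξ, 1 / (M : ℂ) * G ξ * (if ξ = η then (M : ℂ) else 0) := by
        refine Finset.sum_congr rfl fun ξ _ => ?_
        rw [← sum_exp_mul_conj_exp ξ η, Finset.mul_sum]
        refine Finset.sum_congr rfl fun j _ => ?_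
        simp only [mul_right_comm _ ((j : ℕ) : ℂ)]
        ring
    _ = G η := by
        simp only [mul_ite, mul_zero, Finset.sum_ite_eq', Finset.mem_univ, if_true]
        field_simp

theorem dft_sub (M : ℕ) (F G : Fin M → ℂ) (ξ : Fin M) :
    dft M (fun j => F j - G j) ξ = dft M F ξ - dft M G ξ := by
  simp only [dft, sub_mul, Finset.sum_sub_distrib]

/-- The real functions whose discrete Fourier transform vanishes outside `S`. -/
noncomputable def bandlimited {M : ℕ} (S : Finset (Fin M)) :
    Submodule ℝ (EuclideanSpace ℝ (Fin M)) where
  carrier := {q | ∀ ξ ∉ S, dft M (fun j => (q j : ℂ)) ξ = 0}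
  zero_mem' := by
    intro ξ _
    simp [dft]
  add_mem' := by
    intro a b ha hb ξ hξ
    have h1 := ha ξ hξ
    have h2 := hb ξ hξ
    simp only [dft] at h1 h2 ⊢
    simp only [PiLp.add_apply, Complex.ofReal_add, add_mul, Finset.sum_add_distrib, h1, h2,
      add_zero]
  smul_mem' := by
    intro c a ha ξ hξ
    have h1 := ha ξ hξ
    simp only [dft] at h1 ⊢
    simp only [PiLp.smul_apply, smul_eq_mul, Complex.ofReal_mul, mul_assoc]
    rw [← Finset.mul_sum]
    simp only [← mul_assoc] at h1 ⊢
    rw [h1, mul_zero]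

theorem l2norm_sub_idft_le {M : ℕ} {S : Finset (Fin M)} (hM : 0 < M)
    {Q r : EuclideanSpace ℝ (Fin M)} (hr : Q - r ∈ bandlimited S) {ε : ℝ} (hε : 0 ≤ ε)
    (hrε : ‖r‖ ^ 2 ≤ ε ^ 2) {g : Fin M → ℂ}
    (hg : ∑ ξ, ‖restrict S (dft M (fun j => (Q j : ℂ))) ξ - restrict S g ξ‖ ^ 2 ≤
      ε ^ 2 * M / 100) :
    l2norm (fun j => (Q j : ℂ) - idft M (restrict S g) j) ≤ 6 * ε / 5 := by
  have hM' : (0 : ℝ) < M := by exact_mod_cast hM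
  refine Real.sqrt_le_iff.2 ⟨by positivity, ?_⟩
  refine le_of_mul_le_mul_left ?_ hM'
  rw [← sum_norm_sq_dft]
  simp only [dft_sub, dft_idft]
  have hoff : ∀ ξ ∉ S, dft M (fun j => (Q j : ℂ)) ξ = dft M (fun j => (r j : ℂ)) ξ := by
    intro ξ hξ
    have h := hr ξ hξ
    simp only [PiLp.sub_apply, Complex.ofReal_sub, dft_sub] at h
    exact sub_eq_zero.1 h
  have hterm : ∀ ξ, ‖dft M (fun j => (Q j : ℂ)) ξ - restrict S g ξ‖ ^ 2 ≤
      ‖restrict S (dft M (fun j => (Q j : ℂ))) ξ - restrict S g ξ‖ ^ 2 +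
        ‖dft M (fun j => (r j : ℂ)) ξ‖ ^ 2 := by
    intro ξ
    by_cases hξ : ξ ∈ S
    · simp only [restrict, hξ, if_true]
      exact le_add_of_nonneg_right (sq_nonneg _)
    · simp only [restrict, hξ, if_false, hoff ξ hξ, sub_zero]
      exact le_add_of_nonneg_left (sq_nonneg _)
  have hsum := Finset.sum_le_sum fun ξ (_ : ξ ∈ Finset.univ) => hterm ξ
  rw [Finset.sum_add_distrib, sum_norm_sq_dft] at hsum
  have hrn : ∑ j, ‖(r j : ℂ)‖ ^ 2 = ‖r‖ ^ 2 := by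
    simp only [EuclideanSpace.norm_sq_eq, Complex.norm_real]
  rw [hrn] at hsum
  nlinarith [mul_le_mul_of_nonneg_left hrε hM'.le, mul_nonneg hM'.le (sq_nonneg ε)]

/-- The matrix of the orthogonal projection onto the complement of a subspace. -/
noncomputable def complementKernel {α : Type*} [Fintype α] [DecidableEq α]
    (V : Submodule ℝ (EuclideanSpace ℝ α)) (a b : α) : ℝ :=
  inner ℝ (EuclideanSpace.basisFun α ℝ a) (Vᗮ.starProjection (EuclideanSpace.basisFun α ℝ b))

theorem complementKernel_comm {α : Type*} [Fintype α] [DecidableEq α]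
    (V : Submodule ℝ (EuclideanSpace ℝ α)) (a b : α) :
    complementKernel V a b = complementKernel V b a := by
  rw [complementKernel, complementKernel, ← Submodule.inner_starProjection_left_eq_right,
    real_inner_comm]

theorem sum_complementKernel_mul {α : Type*} [Fintype α] [DecidableEq α]
    (V : Submodule ℝ (EuclideanSpace ℝ α)) (a c : α) :
    ∑ b, complementKernel V a b * complementKernel V b c = complementKernel V a c := by
  simp only [complementKernel, ← Submodule.inner_starProjection_left_eq_right _
    (EuclideanSpace.basisFun α ℝ a)]
  simp only [OrthonormalBasis.sum_inner_mul_inner]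
  rw [Submodule.inner_starProjection_left_eq_right, Submodule.inner_starProjection_left_eq_right]
  congr 1
  exact Submodule.starProjection_eq_self_iff.2 (Submodule.starProjection_apply_mem _ _)

theorem starProjection_apply_eq_sum {α : Type*} [Fintype α] [DecidableEq α]
    (V : Submodule ℝ (EuclideanSpace ℝ α)) (q : EuclideanSpace ℝ α) (a : α) :
    Vᗮ.starProjection q a = ∑ b, q b * complementKernel V b a := by
  have h := OrthonormalBasis.sum_inner_mul_inner (EuclideanSpace.basisFun α ℝ) q
    (Vᗮ.starProjection (EuclideanSpace.basisFun α ℝ a))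
  rw [← Submodule.inner_starProjection_left_eq_right, EuclideanSpace.basisFun_apply,
    EuclideanSpace.inner_single_right] at h
  simp only [conj_trivial, one_mul] at h
  rw [h.symm]
  refine Finset.sum_congr rfl fun b _ => ?_
  rw [complementKernel, EuclideanSpace.basisFun_apply, EuclideanSpace.basisFun_apply,
    EuclideanSpace.inner_single_right]
  simp

end Fourier

section Tester

theorem goodOutcome_of_accurate {M : ℕ} (hM : 0 < M) {S : Finset (Fin M)} {ε b : ℝ}
    (hε : 0 < ε) {Q : Fin M → ℝ} {z w : ℝ} {g : Fin M → ℂ}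
    (hz : |z - ∑ j, Q j ^ 2| < (∑ j, Q j ^ 2) / 4)
    (hw : ∑ j, Q j ^ 2 ≤ 2 * b →
      |w - ‖(bandlimited S)ᗮ.starProjection (WithLp.toLp 2 Q)‖ ^ 2| <
        max (‖(bandlimited S)ᗮ.starProjection (WithLp.toLp 2 Q)‖ ^ 2) (ε ^ 2) / 4)
    (hg : ∑ ξ, ‖restrict S (dft M (fun j => (Q j : ℂ))) ξ - restrict S g ξ‖ ^ 2 ≤
      ε ^ 2 * M / 100) (out : Option (Fin M → ℂ))
    (hnone : 3 / 2 * b < z ∨ ε ^ 2 / 2 < w → out = none)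
    (hsome : ¬(3 / 2 * b < z ∨ ε ^ 2 / 2 < w) → out = some g) :
    GoodOutcome M S ε b Q out := by
  set q : EuclideanSpace ℝ (Fin M) := WithLp.toLp 2 Q with hq
  set r := (bandlimited S)ᗮ.starProjection q with hr
  set p := ∑ j, Q j ^ 2 with hp
  rw [abs_lt] at hz
  have hqr : q - r ∈ bandlimited S := by
    rw [hr, Submodule.starProjection_orthogonal_val, sub_sub_cancel]
    exact Submodule.starProjection_apply_mem _ _
  have hrej : p ≤ 2 * b → ε ^ 2 < ‖r‖ ^ 2 → out = none := by
    intro hpb h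
    have h2 := hw hpb
    rw [max_eq_left h.le, abs_lt] at h2
    exact hnone (Or.inr (by linarith))
  refine ⟨fun h => hnone (Or.inl (by linarith)), ?_, ?_, ?_⟩
  · rintro ⟨hpb, hfar⟩
    refine hrej hpb ?_
    have h := hfar (fun j => (q - r) j) hqr
    have hsq : √(∑ j, (Q j - (q - r) j) ^ 2) = ‖r‖ := by
      rw [EuclideanSpace.norm_eq]
      congr 1
      refine Finset.sum_congr rfl fun j _ => ?_
      rw [Real.norm_eq_abs, sq_abs, PiLp.sub_apply, hq, sub_sub_cancel]
    rw [hsq] at h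
    gcongr
  · rintro ⟨hpb, Qstar, hQstar, hclose⟩
    have hmem : (WithLp.toLp 2 Qstar : EuclideanSpace ℝ (Fin M)) ∈ bandlimited S := hQstar
    have hnorm : √(∑ j, (Q j - Qstar j) ^ 2) = ‖q - WithLp.toLp 2 Qstar‖ := by
      rw [EuclideanSpace.norm_eq]
      congr 1
      refine Finset.sum_congr rfl fun j _ => ?_
      rw [Real.norm_eq_abs, sq_abs, PiLp.sub_apply]
    have hr' : r = (bandlimited S)ᗮ.starProjection (q - WithLp.toLp 2 Qstar) := by
      rw [map_sub, Submodule.starProjection_orthogonal_apply_eq_zero hmem, sub_zero]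
    have hle : ‖r‖ ≤ ε / 2 := by
      rw [hr']
      exact (Submodule.norm_starProjection_apply_le _ _).trans (hnorm ▸ hclose)
    have hle2 : ‖r‖ ^ 2 ≤ (ε / 2) ^ 2 := by gcongr
    have hε2 : 0 < ε ^ 2 := by positivity
    have hp0 : 0 ≤ p := Finset.sum_nonneg fun _ _ => sq_nonneg _
    have h2 := hw (by linarith)
    rw [max_eq_right (by linarith), abs_lt] at h2
    rw [hsome (by rintro (h | h) <;> linarith)]
    simp
  · intro f hf
    have hfg : f = g := by
      by_cases h : 3 / 2 * b < z ∨ ε ^ 2 / 2 < w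
      · rw [hnone h] at hf
        cases hf
      · rw [hsome h] at hf
        exact (Option.some.inj hf).symm
    subst hfg
    have hpb : p ≤ 2 * b := by
      by_contra hlt
      rw [hnone (Or.inl (by linarith))] at hf
      cases hf
    have hrε : ‖r‖ ^ 2 ≤ ε ^ 2 := by
      by_contra hlt
      rw [hrej hpb (not_le.1 hlt)] at hf
      cases hf
    refine ⟨Real.sqrt_le_iff.2 ⟨by positivity, hg.trans_eq ?_⟩,
      l2norm_sub_idft_le hM (Q := q) hqr hε.le hrε hg⟩
    rw [div_pow, mul_pow, Real.sq_sqrt (Nat.cast_nonneg M)]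
    norm_num

/-- The Fourier coefficients of the empirical distribution of the samples `x ∘ u`. -/
noncomputable def empiricalDft {M m : ℕ} {ι : Type*} (u : Fin m → ι) (x : ι → Fin M)
    (ξ : Fin M) : ℂ :=
  (∑ i, Complex.exp (-(2 * (Real.pi : ℂ) * Complex.I * ((ξ : ℕ) : ℂ) *
    ((x (u i) : ℕ) : ℂ)) / (M : ℂ))) / m

theorem iidMean_sum_norm_sq_empiricalDft_le {M m : ℕ} {ι : Type*} [Fintype ι] [DecidableEq ι]
    (hm : 0 < m) {Q : Fin M → ℝ} (hQ0 : ∀ a, 0 ≤ Q a) (hQ : ∑ a, Q a = 1) {u : Fin m → ι}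
    (hu : Function.Injective u) (S : Finset (Fin M)) :
    iidMean Q (fun x => ∑ ξ, ‖restrict S (dft M (fun j => (Q j : ℂ))) ξ -
      restrict S (empiricalDft u x) ξ‖ ^ 2) ≤ S.card / m := by
  have h : ∀ x : ι → Fin M, ∑ ξ, ‖restrict S (dft M (fun j => (Q j : ℂ))) ξ -
      restrict S (empiricalDft u x) ξ‖ ^ 2 =
      ∑ ξ ∈ S, ‖dft M (fun j => (Q j : ℂ)) ξ - empiricalDft u x ξ‖ ^ 2 := by
    intro x
    rw [← Finset.sum_subset (Finset.subset_univ S)]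
    · exact Finset.sum_congr rfl fun ξ hξ => by simp only [restrict, hξ, if_true]
    · intro ξ _ hξ
      simp [restrict, hξ]
  simp only [h]
  rw [iidMean_sum, div_eq_mul_one_div, ← nsmul_eq_mul]
  refine Finset.sum_le_card_nsmul _ _ _ fun ξ _ => ?_
  refine iidMean_norm_sq_mean_sub_le hm hQ0 hQ hu (fun a : Fin M =>
    Complex.exp (-(2 * (Real.pi : ℂ) * Complex.I * ((ξ : ℕ) : ℂ) * ((a : ℕ) : ℂ)) / (M : ℂ)))
    fun a => ?_
  rw [Complex.norm_exp]
  simp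

theorem one_le_card_mul_sum_sq {M : ℕ} {Q : Fin M → ℝ} (hQ : ∑ a, Q a = 1) :
    1 ≤ M * ∑ a, Q a ^ 2 := by
  have h := sq_sum_le_card_mul_sum_sq (s := Finset.univ) (f := Q)
  rwa [hQ, one_pow, Finset.card_univ, Fintype.card_fin] at h

open Classical in
theorem seven_tenths_le_iidMean_ind {M m : ℕ} {ι : Type*} [Fintype ι] [DecidableEq ι]
    (hM : 0 < M) {ε b : ℝ} (hε : 0 < ε) (hb : 0 < b) {S : Finset (Fin M)}
    (hmM : 2000 * √M ≤ m) (hmb : 2000 * (√b / ε ^ 2) ≤ m)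
    (hmS : 2000 * (S.card / (M * ε ^ 2)) ≤ (m : ℝ)) {u v : Fin m → ι}
    (hu : Function.Injective u) (hv : Function.Injective v) (huv : ∀ i j, u i ≠ v j)
    {Q : Fin M → ℝ} (hQ0 : ∀ a, 0 ≤ Q a) (hQ : ∑ a, Q a = 1) :
    7 / 10 ≤ iidMean Q (fun x : ι → Fin M => ind (GoodOutcome M S ε b Q
      (if 3 / 2 * b < crossEstimate u v (fun a b => if a = b then 1 else 0) x ∨
          ε ^ 2 / 2 < crossEstimate u v (complementKernel (bandlimited S)) x
        then none else some (empiricalDft u x)))) := by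
  have hM' : (0 : ℝ) < M := by exact_mod_cast hM
  have hm' : (0 : ℝ) < m := lt_of_lt_of_le (by positivity) hmM
  have hm : 0 < m := by exact_mod_cast hm'
  have hε2 : 0 < ε ^ 2 := by positivity
  set p := ∑ j, Q j ^ 2 with hp
  have hMp : 1 ≤ M * p := one_le_card_mul_sum_sq hQ
  have hp0 : 0 < p := by
    by_contra h
    nlinarith [mul_nonneg hM'.le (neg_nonneg.2 (not_lt.1 h))]
  set r := (bandlimited S)ᗮ.starProjection (WithLp.toLp 2 Q) with hr
  set t := max (‖r‖ ^ 2) (ε ^ 2) with ht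
  have ht0 : 0 < t := lt_of_lt_of_le hε2 (le_max_right _ _)
  have hrn : ‖r‖ ^ 2 = ∑ a, r a ^ 2 := by
    simp only [EuclideanSpace.norm_sq_eq, Real.norm_eq_abs, sq_abs]
  set K : Fin M → Fin M → ℝ := fun a b => if a = b then 1 else 0 with hK
  have hcol : iidMean Q (fun x : ι → Fin M =>
      16 / p ^ 2 * (crossEstimate u v K x - p) ^ 2) ≤ 1 / 10 := by
    refine iidMean_crossEstimate_deviation_le hm hQ0 hQ hu hv huv (h := Q) ?_ ?_ ?_ hp0 le_rfl ?_
    · intro a b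
      simp only [hK, eq_comm]
    · intro a c
      simp [hK]
    · intro a
      simp [hK]
    · have h1 : 1 ≤ √M * √p := by
        rw [← Real.sqrt_mul hM'.le]
        exact Real.one_le_sqrt.2 hMp
      calc √p ≤ √p * (√M * √p) := le_mul_of_one_le_right (Real.sqrt_nonneg _) h1
        _ = √M * √p ^ 2 := by ring
        _ = √M * p := by rw [Real.sq_sqrt hp0.le]
        _ ≤ (m / 1000) * p := by
          gcongr
          linarith [Real.sqrt_nonneg (M : ℝ)]
        _ = _ := by ring
  have hproj : p ≤ 2 * b → iidMean Q (fun x : ι → Fin M =>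
      16 / t ^ 2 * (crossEstimate u v (complementKernel (bandlimited S)) x - ‖r‖ ^ 2) ^ 2) ≤
        1 / 10 := by
    intro hpb
    rw [hrn]
    refine iidMean_crossEstimate_deviation_le hm hQ0 hQ hu hv huv (h := r)
      (complementKernel_comm _) (sum_complementKernel_mul _)
      (starProjection_apply_eq_sum _ _) ht0 (hrn ▸ le_max_left _ _) ?_
    have h1 : √p ≤ 2 * √b := by
      refine Real.sqrt_le_iff.2 ⟨by positivity, ?_⟩
      rw [mul_pow, Real.sq_sqrt hb.le]
      linarith
    have h2 : 2000 * √b ≤ m * ε ^ 2 := by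
      rwa [← mul_div_assoc, div_le_iff₀ hε2] at hmb
    have h3 : m * ε ^ 2 ≤ m * t := by
      gcongr
      exact le_max_right _ _
    linarith
  have hfour : iidMean Q (fun x : ι → Fin M => 100 / (ε ^ 2 * M) *
      ∑ ξ, ‖restrict S (dft M (fun j => (Q j : ℂ))) ξ -
        restrict S (empiricalDft u x) ξ‖ ^ 2) ≤ 1 / 10 := by
    rw [iidMean_const_mul]
    calc _ ≤ 100 / (ε ^ 2 * M) * (S.card / m) := by
          gcongr
          exact iidMean_sum_norm_sq_empiricalDft_le hm hQ0 hQ hu S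
      _ = 100 * (S.card / (M * ε ^ 2)) / m := by
          field_simp
      _ ≤ 1 / 10 := by
          rw [div_le_iff₀ hm']
          linarith
  have hpt : ∀ x : ι → Fin M, 1 ≤ ind (GoodOutcome M S ε b Q
      (if 3 / 2 * b < crossEstimate u v K x ∨
          ε ^ 2 / 2 < crossEstimate u v (complementKernel (bandlimited S)) x
        then none else some (empiricalDft u x))) +
      (16 / p ^ 2 * (crossEstimate u v K x - p) ^ 2 +
      ((if p ≤ 2 * b then 1 else 0) * (16 / t ^ 2 *
        (crossEstimate u v (complementKernel (bandlimited S)) x - ‖r‖ ^ 2) ^ 2) +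
      100 / (ε ^ 2 * M) * ∑ ξ, ‖restrict S (dft M (fun j => (Q j : ℂ))) ξ -
        restrict S (empiricalDft u x) ξ‖ ^ 2)) := by
    intro x
    have hind : ∀ P : Prop, 0 ≤ ind P := fun P => by
      unfold ind
      split_ifs <;> norm_num
    have habs : ∀ {y s : ℝ}, 0 < s → 16 / s ^ 2 * y ^ 2 < 1 → |y| < s / 4 := by
      intro y s hs h
      rw [div_mul_eq_mul_div, div_lt_one (by positivity)] at h
      exact abs_lt_of_sq_lt_sq (by linarith [div_pow s 4 2]) (by positivity)
    set D := ∑ ξ, ‖restrict S (dft M (fun j => (Q j : ℂ))) ξ -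
        restrict S (empiricalDft u x) ξ‖ ^ 2 with hD
    have hD0 : 0 ≤ D := Finset.sum_nonneg fun _ _ => sq_nonneg _
    set F₁ := 16 / p ^ 2 * (crossEstimate u v K x - p) ^ 2 with hF₁
    set F₂ := (if p ≤ 2 * b then (1 : ℝ) else 0) * (16 / t ^ 2 *
        (crossEstimate u v (complementKernel (bandlimited S)) x - ‖r‖ ^ 2) ^ 2) with hF₂
    set F₃ := 100 / (ε ^ 2 * M) * D with hF₃
    have hF₁0 : 0 ≤ F₁ := by positivity
    have hF₂0 : 0 ≤ F₂ := by
      rw [hF₂]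
      split_ifs <;> positivity
    have hF₃0 : 0 ≤ F₃ := by positivity
    by_cases hall : F₁ < 1 ∧ F₂ < 1 ∧ F₃ < 1
    · obtain ⟨h1, h2, h3⟩ := hall
      rw [ind, if_pos]
      · linarith
      refine goodOutcome_of_accurate hM (g := empiricalDft u x) hε (habs hp0 h1) (fun hpb => ?_)
        ?_ _ (fun hc => if_pos hc) (fun hc => if_neg hc)
      · rw [hF₂, if_pos hpb, one_mul] at h2
        exact habs ht0 h2
      · rw [hF₃, div_mul_eq_mul_div, div_lt_one (by positivity)] at h3
        linarith
    · refine le_trans ?_ (le_add_of_nonneg_left (hind _))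
      by_contra hlt
      exact hall ⟨by linarith, by linarith, by linarith⟩
  have hE := iidMean_mono hQ0 hpt
  rw [iidMean_const hQ, iidMean_add, iidMean_add, iidMean_add] at hE
  have hproj' : iidMean Q (fun x : ι → Fin M => (if p ≤ 2 * b then (1 : ℝ) else 0) *
      (16 / t ^ 2 * (crossEstimate u v (complementKernel (bandlimited S)) x - ‖r‖ ^ 2) ^ 2)) ≤
        1 / 10 := by
    rw [iidMean_const_mul]
    split_ifs with hpb
    · rw [one_mul]
      exact hproj hpb
    · norm_num
  linarith

end Tester

/-- Testing the effective Fourier support: a randomized algorithm drawing at most `2m`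
i.i.d. samples from `Q` (the algorithm is a function `A` of an internal random seed
drawn from the distribution `R`, and of the samples) whose output satisfies all four
guarantees simultaneously with probability at least `7/10`. -/
theorem fourier_support_testing :
    ∃ C : ℝ, 0 < C ∧
      ∀ M : ℕ, 1 ≤ M → ∀ ε b : ℝ, 0 < ε → ε ≤ 1 → 0 < b → b ≤ 1 →
        ∀ S : Finset (Fin M),
          ∃ m : ℕ,
            (m : ℝ) ≤ C * (Real.sqrt b / ε ^ 2 + (S.card : ℝ) / ((M : ℝ) * ε ^ 2) +
                Real.sqrt M) ∧
            ∃ (A : ℕ → (Fin (2 * m) → Fin M) → Option (Fin M → ℂ)) (R : ℕ → ℝ),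
              (∀ r, 0 ≤ R r) ∧ HasSum R 1 ∧
              ∀ Q : Fin M → ℝ, (∀ j, 0 ≤ Q j) → (∑ j, Q j = 1) →
                (7 / 10 : ℝ) ≤
                  ∑' r : ℕ, ∑' x : Fin (2 * m) → Fin M,
                    R r * (∏ i, Q (x i)) * ind (GoodOutcome M S ε b Q (A r x)) := by
  classical
  refine ⟨2001, by norm_num, ?_⟩
  intro M hM ε b hε _ hb _ S
  have hM0 : 0 < M := hM
  have hMs : 1 ≤ √(M : ℝ) := Real.one_le_sqrt.2 (by exact_mod_cast hM)
  have hS0 : 0 ≤ (S.card : ℝ) / (M * ε ^ 2) := by positivity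
  have hb0 : 0 ≤ √b / ε ^ 2 := by positivity
  set X := √b / ε ^ 2 + (S.card : ℝ) / (M * ε ^ 2) + √M with hX
  obtain ⟨m, hlow, hup⟩ : ∃ m : ℕ, 2000 * X ≤ m ∧ (m : ℝ) ≤ 2001 * X :=
    ⟨⌈2000 * X⌉₊, Nat.le_ceil _, by
      linarith [Nat.ceil_lt_add_one (show 0 ≤ 2000 * X by linarith)]⟩
  let u : Fin m → Fin (2 * m) := fun i => ⟨i, by omega⟩
  let v : Fin m → Fin (2 * m) := fun i => ⟨m + i, by omega⟩
  have hu : Function.Injective u := fun i j h => by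
    simp only [u, Fin.mk.injEq] at h
    omega
  have hv : Function.Injective v := fun i j h => by
    simp only [v, Fin.mk.injEq] at h
    omega
  have huv : ∀ i j, u i ≠ v j := fun i j h => by
    simp only [u, v, Fin.mk.injEq] at h
    omega
  refine ⟨m, hup, fun _ x =>
    if 3 / 2 * b < crossEstimate u v (fun a b => if a = b then 1 else 0) x ∨
        ε ^ 2 / 2 < crossEstimate u v (complementKernel (bandlimited S)) x
      then none else some (empiricalDft u x),
    fun r => if r = 0 then 1 else 0, fun r => by positivity, hasSum_ite_eq 0 1, ?_⟩
  intro Q hQ0 hQ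
  rw [tsum_eq_single 0 (fun r hr => by simp [hr]), tsum_fintype]
  simp only [if_true, one_mul]
  have h := seven_tenths_le_iidMean_ind hM0 hε hb (S := S) (by linarith) (by linarith)
    (by linarith) hu hv huv hQ0 hQ
  simp only [iidMean] at h
  convert h

end Stmt4
end

section
/- Let r ≥ 1 be an integer, ε ∈ (0,1), b > 0, and m a positive integer with m ≥ 61·√b/ε². Let P be a probability distribution on {1,...,r} and P* : {1,...,r} → ℝ a function, with Σ_i P(i)² ≤ b and Σ_i P*(i)² ≤ b. Let X_1,...,X_r be independent random variables with X_i distributed as Poisson(m·P(i)), and set Z = Σ_{i=1}^r ((X_i − m·P*(i))² − X_i). Then: (a) if ‖P − P*‖₂ ≤ ε, Pr[Z ≤ 2.9·m²·ε²] ≥ 3/4; and (b) if ‖P − P*‖₂ ≥ 2ε, Pr[Z ≥ 3.1·m²·ε²] ≥ 3/4. -/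
open scoped BigOperators

namespace Stmt5

open Classical in
/-- Indicator of a proposition, as a real number. -/
noncomputable def ind (p : Prop) : ℝ := if p then 1 else 0

/-- The probability mass function of the Poisson distribution with mean `lam`. -/
noncomputable def poissonP (lam : ℝ) (n : ℕ) : ℝ :=
  Real.exp (-lam) * lam ^ n / (n.factorial : ℝ)

open MeasureTheory ProbabilityTheory
open scoped NNReal

section Cantelli

variable {Ω : Type*} {mΩ : MeasurableSpace Ω} {μ : Measure Ω} [IsProbabilityMeasure μ] {X : Ω → ℝ}

lemma integral_sub_integral_add_const_sq (hX : MemLp X 2 μ) (u : ℝ) :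
    ∫ ω, (X ω - μ[X] + u) ^ 2 ∂μ = Var[X; μ] + u ^ 2 := by
  have hY : MemLp (fun ω ↦ X ω + (u - μ[X])) 2 μ := hX.add (memLp_const _)
  have hvar := variance_eq_sub hY
  have hmean : ∫ ω, (X ω + (u - μ[X])) ∂μ = u := by
    rw [integral_add (hX.integrable (by norm_num)) (integrable_const _)]
    simp
  rw [variance_add_const hX.aestronglyMeasurable, hmean] at hvar
  have hsq : ∫ ω, (X ω - μ[X] + u) ^ 2 ∂μ = ∫ ω, (X ω + (u - μ[X])) ^ 2 ∂μ :=
    integral_congr_ae (ae_of_all _ fun ω ↦ by ring)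
  rw [hsq, hvar]
  simp

/-- The one-sided Chebyshev inequality (Cantelli). -/
lemma measureReal_integral_add_le_le (hX : MemLp X 2 μ) {g : ℝ} (hg : 0 < g) :
    μ.real {ω | μ[X] + g ≤ X ω} ≤ Var[X; μ] / (Var[X; μ] + g ^ 2) := by
  have hval := integral_sub_integral_add_const_sq hX (Var[X; μ] / g)
  have hint : Integrable (fun ω ↦ (X ω - μ[X] + Var[X; μ] / g) ^ 2) μ :=
    ((hX.sub (memLp_const _)).add (memLp_const _)).integrable_sq
  generalize μ[X] = M at *
  have hV : 0 ≤ Var[X; μ] := variance_nonneg X μ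
  generalize Var[X; μ] = V at *
  have hu : 0 ≤ V / g := by positivity
  have markov := mul_meas_ge_le_integral_of_nonneg
    (ae_of_all μ fun ω ↦ sq_nonneg (X ω - M + V / g)) hint ((g + V / g) ^ 2)
  have hsub : μ.real {ω | M + g ≤ X ω} ≤
      μ.real {ω | (g + V / g) ^ 2 ≤ (X ω - M + V / g) ^ 2} := by
    refine measureReal_mono fun ω hω ↦ ?_
    simp only [Set.mem_ofPred_eq] at hω ⊢
    exact pow_le_pow_left₀ (by positivity) (by linarith) 2
  have hbound : μ.real {ω | M + g ≤ X ω} ≤ (V + (V / g) ^ 2) / (g + V / g) ^ 2 := by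
    rw [le_div_iff₀ (by positivity), mul_comm, ← hval]
    exact (mul_le_mul_of_nonneg_left hsub (by positivity)).trans markov
  refine hbound.trans_eq ?_
  field_simp
  ring

lemma div_add_sq_le_quarter {v g : ℝ} (hv : 0 ≤ v) (hg : 0 < g) (h : 3 * v ≤ g ^ 2) :
    v / (v + g ^ 2) ≤ 1 / 4 := by
  rw [div_le_iff₀ (by positivity)]
  linarith

lemma three_quarters_le_measureReal_le (hX : MemLp X 2 μ) {t : ℝ} (ht : μ[X] < t)
    (h : 3 * Var[X; μ] ≤ (t - μ[X]) ^ 2) : 3 / 4 ≤ μ.real {ω | X ω ≤ t} := by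
  have hg : 0 < t - μ[X] := sub_pos.2 ht
  have hc := (measureReal_integral_add_le_le hX hg).trans 
    (div_add_sq_le_quarter (variance_nonneg X μ) hg h)
  have hu : μ.real (Set.univ : Set Ω) ≤
      μ.real {ω | X ω ≤ t} + μ.real {ω | μ[X] + (t - μ[X]) ≤ X ω} := by
    refine (measureReal_mono fun ω _ ↦ ?_).trans (measureReal_union_le _ _)
    rcases le_total (X ω) t with h' | h'
    · exact Or.inl h'
    · exact Or.inr (by simpa using h')
  rw [probReal_univ] at hu
  linarith

lemma three_quarters_le_measureReal_ge (hX : MemLp X 2 μ) {t : ℝ} (ht : t < μ[X])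
    (h : 3 * Var[X; μ] ≤ (μ[X] - t) ^ 2) : 3 / 4 ≤ μ.real {ω | t ≤ X ω} := by
  have hneg := three_quarters_le_measureReal_le (t := -t) hX.neg
    (by simpa [integral_neg] using ht)
    (by simp only [Pi.neg_apply, integral_neg, variance_neg]; linarith)
  simpa using hneg

end Cantelli

section Poisson

lemma hasSum_poisson_descFactorial (r : ℝ≥0) (k : ℕ) :
    HasSum (fun n : ℕ ↦ Real.exp (-r) * r ^ n / n.factorial * (n.descFactorial k : ℝ))
      ((r : ℝ) ^ k) := by
  rw [← hasSum_nat_add_iff' k, Finset.sum_eq_zero, sub_zero]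
  · convert! (hasSum_one_poissonMeasure r).mul_left ((r : ℝ) ^ k) using 1
    · ext n
      have h := Nat.factorial_mul_descFactorial (Nat.le_add_left k n)
      rw [Nat.add_sub_cancel] at h
      have hd : ((n + k).descFactorial k : ℝ) ≠ 0 := by
        exact_mod_cast fun h0 ↦ (Nat.factorial_ne_zero (n + k)) (by rw [← h, h0, mul_zero])
      have hn : (n.factorial : ℝ) ≠ 0 := by exact_mod_cast n.factorial_ne_zero
      rw [← h]
      push_cast
      field_simp
      ring
    · simp
  · intro n hn
    rw [Nat.descFactorial_of_lt (Finset.mem_range.1 hn)]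
    simp

lemma integrable_descFactorial_poissonMeasure (r : ℝ≥0) (k : ℕ) :
    Integrable (fun n : ℕ ↦ (n.descFactorial k : ℝ)) (poissonMeasure r) := by
  rw [integrable_poissonMeasure_iff]
  simpa using (hasSum_poisson_descFactorial r k).summable

/-- The factorial moments of the Poisson distribution. -/
lemma integral_descFactorial_poissonMeasure (r : ℝ≥0) (k : ℕ) :
    ∫ n : ℕ, (n.descFactorial k : ℝ) ∂poissonMeasure r = (r : ℝ) ^ k := by
  rw [integral_poissonMeasure]
  simpa using (hasSum_poisson_descFactorial r k).tsum_eq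

lemma cast_descFactorial_succ (n k : ℕ) :
    (n.descFactorial (k + 1) : ℝ) = (n - k) * n.descFactorial k := by
  rw [Nat.descFactorial_succ, Nat.cast_mul]
  rcases le_total k n with h | h
  · rw [Nat.cast_sub h]
  · rcases h.eq_or_lt with rfl | h
    · simp
    · simp [Nat.descFactorial_of_lt h]

lemma integrable_sum_descFactorial_poissonMeasure (r : ℝ≥0) {N : ℕ} (a : Fin N → ℝ) :
    Integrable (fun n : ℕ ↦ ∑ k, a k * (n.descFactorial k : ℝ)) (poissonMeasure r) :=
  integrable_finsetSum _ fun k _ ↦ (integrable_descFactorial_poissonMeasure r k).const_mul _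

lemma integral_sum_descFactorial_poissonMeasure (r : ℝ≥0) {N : ℕ} (a : Fin N → ℝ) :
    ∫ n : ℕ, ∑ k, a k * (n.descFactorial k : ℝ) ∂poissonMeasure r =
      ∑ k, a k * (r : ℝ) ^ (k : ℕ) := by
  rw [integral_finsetSum _ fun (k : Fin N) _ ↦
    (integrable_descFactorial_poissonMeasure r k).const_mul (a k)]
  simp_rw [integral_const_mul, integral_descFactorial_poissonMeasure]

/-- The coordinate contribution to the test statistic. -/
noncomputable def stat (c : ℝ) (n : ℕ) : ℝ := ((n : ℝ) - c) ^ 2 - n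

lemma stat_eq (c : ℝ) : stat c = fun n : ℕ ↦
    ∑ k : Fin 3, ![c ^ 2, -(2 * c), 1] k * (n.descFactorial k : ℝ) := by
  ext n
  simp only [stat, Fin.sum_univ_succ]
  simp [cast_descFactorial_succ, -Nat.descFactorial_succ]
  ring

lemma stat_sq_eq (c : ℝ) : (fun n ↦ stat c n ^ 2) = fun n : ℕ ↦
    ∑ k : Fin 5, ![c ^ 4, 4 * c ^ 2 - 4 * c ^ 3, 2 - 8 * c + 6 * c ^ 2, 4 - 4 * c, 1] k *
      (n.descFactorial k : ℝ) := by
  ext n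
  simp only [stat, Fin.sum_univ_succ]
  simp [cast_descFactorial_succ, -Nat.descFactorial_succ]
  ring

lemma integral_stat (r : ℝ≥0) (c : ℝ) :
    ∫ n, stat c n ∂poissonMeasure r = (r - c) ^ 2 := by
  rw [stat_eq, integral_sum_descFactorial_poissonMeasure]
  simp [Fin.sum_univ_succ]
  ring

lemma memLp_stat (r : ℝ≥0) (c : ℝ) : MemLp (stat c) 2 (poissonMeasure r) := by
  rw [memLp_two_iff_integrable_sq .of_discrete, stat_sq_eq]
  exact integrable_sum_descFactorial_poissonMeasure r _

lemma variance_stat (r : ℝ≥0) (c : ℝ) :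
    Var[stat c; poissonMeasure r] = 2 * (r : ℝ) ^ 2 + 4 * r * (r - c) ^ 2 := by
  have hsq : ∫ n, stat c n ^ 2 ∂poissonMeasure r = (r : ℝ) ^ 4 + (4 - 4 * c) * r ^ 3 +
      (2 - 8 * c + 6 * c ^ 2) * r ^ 2 + (4 * c ^ 2 - 4 * c ^ 3) * r + c ^ 4 := by
    rw [stat_sq_eq, integral_sum_descFactorial_poissonMeasure]
    simp [Fin.sum_univ_succ]
    ring
  rw [variance_eq_sub (memLp_stat r c), integral_stat]
  simp only [Pi.pow_apply, hsq]
  ring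

end Poisson

section Product

variable {ι : Type*} [Fintype ι]

lemma memLp_sum_stat (q : ι → ℝ≥0) (c : ι → ℝ) :
    MemLp (fun x : ι → ℕ ↦ ∑ i, stat (c i) (x i)) 2
      (Measure.pi fun i ↦ poissonMeasure (q i)) :=
  memLp_finsetSum _ fun i _ ↦ (memLp_stat (q i) (c i)).comp_measurePreserving
    (measurePreserving_eval (fun i ↦ poissonMeasure (q i)) i)

lemma integral_sum_stat (q : ι → ℝ≥0) (c : ι → ℝ) :
    ∫ x : ι → ℕ, ∑ i, stat (c i) (x i) ∂(Measure.pi fun i ↦ poissonMeasure (q i)) =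
      ∑ i, ((q i : ℝ) - c i) ^ 2 := by
  rw [integral_finsetSum _ fun i _ ↦ integrable_comp_eval (μ := fun i ↦ poissonMeasure (q i))
    ((memLp_stat (q i) (c i)).integrable (by norm_num))]
  refine Finset.sum_congr rfl fun i _ ↦ ?_
  rw [integral_comp_eval (μ := fun i ↦ poissonMeasure (q i)) .of_discrete, integral_stat]

lemma variance_sum_stat (q : ι → ℝ≥0) (c : ι → ℝ) :
    Var[fun x : ι → ℕ ↦ ∑ i, stat (c i) (x i); Measure.pi fun i ↦ poissonMeasure (q i)] =
      ∑ i, (2 * (q i : ℝ) ^ 2 + 4 * q i * (q i - c i) ^ 2) := by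
  simp_rw [← variance_stat]
  rw [← variance_sum_pi fun i ↦ memLp_stat (q i) (c i)]
  congr 1
  ext x
  simp

lemma tsum_poissonP_mul_ind (q : ι → ℝ≥0) (p : (ι → ℕ) → Prop) :
    ∑' x : ι → ℕ, (∏ i, poissonP (q i) (x i)) * ind (p x) =
      (Measure.pi fun i ↦ poissonMeasure (q i)).real {x | p x} := by
  classical
  rw [← integral_indicator_one (.of_discrete), integral_countable
    ((integrable_indicator_iff .of_discrete).2 (integrable_const 1).integrableOn)]
  refine tsum_congr fun x ↦ ?_
  have hx : (Measure.pi fun i ↦ poissonMeasure (q i)).real {x} = ∏ i, poissonP (q i) (x i) := by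
    rw [measureReal_def, Measure.pi_singleton, ENNReal.toReal_prod]
    exact Finset.prod_congr rfl fun i _ ↦ poissonMeasure_real_singleton (q i) (x i)
  rw [hx, smul_eq_mul]
  simp [ind, Set.indicator_apply]

end Product

/-- With `D = ‖P - P*‖₂²`, the variance of the statistic is at most `2 m² b + 4 m³ √b D`. -/
lemma sum_variance_le {ι : Type*} [Fintype ι] {m b : ℝ} (hm : 0 ≤ m) {P Q : ι → ℝ}
    (hPb : ∑ i, P i ^ 2 ≤ b) :
    ∑ i, (2 * (m * P i) ^ 2 + 4 * (m * P i) * (m * P i - m * Q i) ^ 2) ≤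
      2 * m ^ 2 * b + 4 * m ^ 3 * Real.sqrt b * ∑ i, (P i - Q i) ^ 2 := by
  have hP (i : ι) : P i ≤ Real.sqrt b := Real.le_sqrt_of_sq_le <|
    (Finset.single_le_sum (f := fun i ↦ P i ^ 2) (fun _ _ ↦ sq_nonneg _)
      (Finset.mem_univ i)).trans hPb
  calc _ ≤ ∑ i, (2 * m ^ 2 * P i ^ 2 + 4 * m ^ 3 * Real.sqrt b * (P i - Q i) ^ 2) := by
        refine Finset.sum_le_sum fun i _ ↦ ?_
        have := mul_le_mul_of_nonneg_left (hP i)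
          (show 0 ≤ 4 * m ^ 3 * (P i - Q i) ^ 2 by positivity)
        linarith
    _ = 2 * m ^ 2 * ∑ i, P i ^ 2 + 4 * m ^ 3 * Real.sqrt b * ∑ i, (P i - Q i) ^ 2 := by
        rw [Finset.sum_add_distrib, Finset.mul_sum, Finset.mul_sum]
    _ ≤ _ := by gcongr

lemma three_mul_variance_bound_le_of_le {m s e D : ℝ} (hm : 0 < m) (he : 0 < e) (hs : 0 ≤ s)
    (hme : 61 * s ≤ m * e) (hD : D ≤ e) :
    3 * (2 * m ^ 2 * s ^ 2 + 4 * m ^ 3 * s * D) ≤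
      (29 / 10 * m ^ 2 * e - m ^ 2 * D) ^ 2 := by
  have h1 : s ^ 2 ≤ (m * e / 61) ^ 2 := pow_le_pow_left₀ hs (by linarith) 2
  have h2 : s * D ≤ m * e / 61 * e := mul_le_mul_of_nonneg_left hD hs |>.trans
    (mul_le_mul_of_nonneg_right (by linarith) he.le)
  have h3 : (19 / 10 * e) ^ 2 ≤ (29 / 10 * e - D) ^ 2 :=
    pow_le_pow_left₀ (by positivity) (by linarith) 2
  have k1 := mul_le_mul_of_nonneg_left h1 (show 0 ≤ 6 * m ^ 2 by positivity)
  have k2 := mul_le_mul_of_nonneg_left h2 (show 0 ≤ 12 * m ^ 3 by positivity)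
  have k3 := mul_le_mul_of_nonneg_left h3 (show 0 ≤ m ^ 4 by positivity)
  have k4 : 0 ≤ m ^ 4 * e ^ 2 := by positivity
  linarith

lemma three_mul_variance_bound_le_of_ge {m s e D : ℝ} (hm : 0 < m) (he : 0 < e) (hs : 0 ≤ s)
    (hme : 61 * s ≤ m * e) (hD : 4 * e ≤ D) :
    3 * (2 * m ^ 2 * s ^ 2 + 4 * m ^ 3 * s * D) ≤
      (m ^ 2 * D - 31 / 10 * m ^ 2 * e) ^ 2 := by
  have h1 : s ^ 2 ≤ (m * e / 61) ^ 2 := pow_le_pow_left₀ hs (by linarith) 2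
  have h2 : s * D ≤ m * e / 61 * D := mul_le_mul_of_nonneg_right (by linarith) (by linarith)
  have h3 : 6 / 3721 * e ^ 2 + 12 / 61 * e * D ≤ (D - 31 / 10 * e) ^ 2 := by
    nlinarith [mul_nonneg he.le (sub_nonneg.2 hD), sq_nonneg (D - 4 * e)]
  have k1 := mul_le_mul_of_nonneg_left h1 (show 0 ≤ 6 * m ^ 2 by positivity)
  have k2 := mul_le_mul_of_nonneg_left h2 (show 0 ≤ 12 * m ^ 3 by positivity)
  have k3 := mul_le_mul_of_nonneg_left h3 (show 0 ≤ m ^ 4 by positivity)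
  linarith

/-- Analysis of the tolerant `L₂` identity tester: with `X_i ∼ Poisson(m·P(i))` independent
and `Z = Σᵢ ((Xᵢ - m·P*(i))² - Xᵢ)`, if `‖P - P*‖₂ ≤ ε` then `Z ≤ 2.9 m²ε²` with probability
at least `3/4`, and if `‖P - P*‖₂ ≥ 2ε` then `Z ≥ 3.1 m²ε²` with probability at least `3/4`,
provided `m ≥ 61·√b/ε²` where `b` bounds `‖P‖₂², ‖P*‖₂²`. -/
theorem tolerant_l2_identity_tester
    (r : ℕ) (hr : 1 ≤ r) (ε b : ℝ) (hε : 0 < ε) (hε1 : ε < 1) (hb : 0 < b)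
    (m : ℕ) (hm : 1 ≤ m) (hmb : 61 * Real.sqrt b / ε ^ 2 ≤ (m : ℝ))
    (P Pstar : Fin r → ℝ) (hP0 : ∀ i, 0 ≤ P i) (hP1 : ∑ i, P i = 1)
    (hPb : ∑ i, P i ^ 2 ≤ b) (hPsb : ∑ i, Pstar i ^ 2 ≤ b) :
    (Real.sqrt (∑ i, (P i - Pstar i) ^ 2) ≤ ε →
      (3 / 4 : ℝ) ≤
        ∑' x : Fin r → ℕ,
          (∏ i, poissonP ((m : ℝ) * P i) (x i)) *
            ind ((∑ i, (((x i : ℝ) - (m : ℝ) * Pstar i) ^ 2 - (x i : ℝ))) ≤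
              (29 / 10) * (m : ℝ) ^ 2 * ε ^ 2)) ∧
    (2 * ε ≤ Real.sqrt (∑ i, (P i - Pstar i) ^ 2) →
      (3 / 4 : ℝ) ≤
        ∑' x : Fin r → ℕ,
          (∏ i, poissonP ((m : ℝ) * P i) (x i)) *
            ind ((31 / 10) * (m : ℝ) ^ 2 * ε ^ 2 ≤
              (∑ i, (((x i : ℝ) - (m : ℝ) * Pstar i) ^ 2 - (x i : ℝ))))) := by
  have hm0 : (0 : ℝ) < m := by exact_mod_cast hm
  have he : 0 < ε ^ 2 := by positivity
  have hme : 61 * Real.sqrt b ≤ m * ε ^ 2 := (div_le_iff₀ he).1 hmb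
  have hmP (i : Fin r) : 0 ≤ (m : ℝ) * P i := mul_nonneg hm0.le (hP0 i)
  let q : Fin r → ℝ≥0 := fun i ↦ ⟨m * P i, hmP i⟩
  have hq (i : Fin r) : (m : ℝ) * P i = q i := rfl
  set D := ∑ i, (P i - Pstar i) ^ 2 with hDdef
  have hD0 : 0 ≤ D := Finset.sum_nonneg fun _ _ ↦ sq_nonneg _
  let μ := Measure.pi fun i ↦ poissonMeasure (q i)
  let Z : (Fin r → ℕ) → ℝ := fun x ↦ ∑ i, stat (m * Pstar i) (x i)
  have hZ : MemLp Z 2 μ := memLp_sum_stat q _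
  have hmean : μ[Z] = m ^ 2 * D := by
    refine (integral_sum_stat q _).trans ?_
    rw [hDdef, Finset.mul_sum]
    refine Finset.sum_congr rfl fun i _ ↦ ?_
    rw [← hq]
    ring
  have hvar : 3 * Var[Z; μ] ≤
      3 * (2 * m ^ 2 * Real.sqrt b ^ 2 + 4 * m ^ 3 * Real.sqrt b * D) := by
    rw [Real.sq_sqrt hb.le]
    exact mul_le_mul_of_nonneg_left
      ((variance_sum_stat q _).trans_le (sum_variance_le hm0.le hPb)) (by norm_num)
  simp_rw [hq]
  constructor
  · intro h
    have hD : D ≤ ε ^ 2 := (Real.sqrt_le_left hε.le).1 h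
    rw [tsum_poissonP_mul_ind]
    refine three_quarters_le_measureReal_le (X := Z) hZ ?_ (hvar.trans ?_)
    · rw [hmean]
      have := mul_le_mul_of_nonneg_left hD (show 0 ≤ (m : ℝ) ^ 2 by positivity)
      have : 0 < (m : ℝ) ^ 2 * ε ^ 2 := by positivity
      linarith
    · rw [hmean]
      exact three_mul_variance_bound_le_of_le hm0 he (Real.sqrt_nonneg b) hme hD
  · intro h
    have hD : 4 * ε ^ 2 ≤ D := by
      have := (Real.le_sqrt (by positivity) hD0).1 h
      linarith
    rw [tsum_poissonP_mul_ind]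
    refine three_quarters_le_measureReal_ge (X := Z) hZ ?_ (hvar.trans ?_)
    · rw [hmean]
      have := mul_le_mul_of_nonneg_left hD (show 0 ≤ (m : ℝ) ^ 2 by positivity)
      have : 0 < (m : ℝ) ^ 2 * ε ^ 2 := by positivity
      linarith
    · rw [hmean]
      exact three_mul_variance_bound_le_of_ge hm0 he (Real.sqrt_nonneg b) hme hD

end Stmt5
end

section
/- Let P be an (n,k)-SIIRV with variance s² > 0, and let M be a positive integer with M > s. Then the distribution P' of (X mod M) for X ∼ P satisfies ‖P'‖₂ ≤ √(8k/s), i.e., Σ_{j=0}^{M-1} P'(j)² ≤ 8k/s. -/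
open scoped BigOperators

namespace Stmt7

/-- The class of (n,k)-SIIRVs: distributions on `ℕ` of sums of `n` independent
random variables each taking values in `{0, 1, …, k-1}`. -/
def SIIRVclass (n k : ℕ) : Set (ℕ → ℝ) :=
  { P | ∃ p : Fin n → Fin k → ℝ,
      (∀ i, (∀ j, 0 ≤ p i j) ∧ ∑ j, p i j = 1) ∧
      ∀ t : ℕ,
        P t = ∑ x : Fin n → Fin k,
          (if (∑ i, ((x i : ℕ))) = t then ∏ i, p i (x i) else 0) }

/-- The mean of a distribution on `ℕ`. -/
noncomputable def distMean (P : ℕ → ℝ) : ℝ := ∑' j : ℕ, P j * (j : ℝ)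

/-- The variance of a distribution on `ℕ`. -/
noncomputable def distVar (P : ℕ → ℝ) : ℝ := ∑' j : ℕ, P j * ((j : ℝ) - distMean P) ^ 2

theorem sum_inv_one_add_sq_le {a : ℝ} (ha : 0 < a) (N : ℕ) :
    ∑ r ∈ Finset.range N, 1 / (1 + (a * ((r : ℝ) + 1)) ^ 2) ≤ 2 / a := by
  suffices h : ∑ r ∈ Finset.range N, 1 / (1 + (a * ((r : ℝ) + 1)) ^ 2)
      ≤ 2 / a - 2 / (a * (1 + a * N)) by
    have : 0 ≤ 2 / (a * (1 + a * N)) := by positivity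
    linarith
  induction N with
  | zero => simp
  | succ N ih =>
    rw [Finset.sum_range_succ]
    have key : 1 / (1 + (a * ((N : ℝ) + 1)) ^ 2)
        ≤ 2 / (a * (1 + a * N)) - 2 / (a * (1 + a * (N + 1))) := by
      have h : 2 / (a * (1 + a * N)) - 2 / (a * (1 + a * (N + 1)))
          = 2 / ((1 + a * N) * (1 + a * (N + 1))) := by
        field_simp
        ring
      rw [h, div_le_div_iff₀ (by positivity) (by positivity)]
      have : 0 ≤ a * N := by positivity
      nlinarith [sq_nonneg (a * ((N : ℝ) + 1) - 1)]
    push_cast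
    linarith

theorem exp_neg_mul_sin_sq_le {N : ℕ} (hN : 0 < N) (t : ℝ) {x : ℝ} (hx : 0 ≤ x)
    (hxN : 2 * x ≤ N) :
    Real.exp (-(t ^ 2 * Real.sin (Real.pi * x / N) ^ 2)) ≤ 1 / (1 + (2 * t / N * x) ^ 2) := by
  have hN' : (0 : ℝ) < N := by exact_mod_cast hN
  have hsin : 2 * (x / N) ≤ Real.sin (Real.pi * x / N) := by
    have h := Real.mul_le_sin (x := Real.pi * x / N) (by positivity) (by
      rw [div_le_div_iff₀ hN' two_pos]
      nlinarith [Real.pi_pos])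
    refine le_trans (le_of_eq ?_) h
    field_simp
  have hsq : (2 * t / N * x) ^ 2 ≤ t ^ 2 * Real.sin (Real.pi * x / N) ^ 2 := by
    have : (2 * (x / N)) ^ 2 ≤ Real.sin (Real.pi * x / N) ^ 2 :=
      pow_le_pow_left₀ (by positivity) hsin 2
    calc (2 * t / N * x) ^ 2 = t ^ 2 * (2 * (x / N)) ^ 2 := by ring
      _ ≤ _ := by gcongr
  rw [Real.exp_neg, ← one_div]
  apply one_div_le_one_div_of_le (by positivity)
  linarith [Real.add_one_le_exp (t ^ 2 * Real.sin (Real.pi * x / N) ^ 2)]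

theorem sum_exp_neg_mul_sin_sq_le {N : ℕ} (hN : 0 < N) {t : ℝ} (ht : 0 < t) :
    ∑ r ∈ Finset.range N, Real.exp (-(t ^ 2 * Real.sin (Real.pi * r / N) ^ 2))
      ≤ 1 + 2 * N / t := by
  have hN' : (0 : ℝ) < N := by exact_mod_cast hN
  set a : ℝ := 2 * t / N with ha
  have ha0 : 0 < a := by positivity
  let ψ : ℝ → ℝ := fun x ↦ 1 / (1 + (a * x) ^ 2)
  have hψ (x : ℝ) : 0 ≤ ψ x := by positivity
  have hpt : ∀ r ∈ Finset.range N,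
      Real.exp (-(t ^ 2 * Real.sin (Real.pi * r / N) ^ 2)) ≤ ψ r + ψ (((N - 1 - r : ℕ) : ℝ) + 1) := by
    intro r hr
    have hr' : r + 1 ≤ N := Finset.mem_range.mp hr
    have hcast : ((N - 1 - r : ℕ) : ℝ) + 1 = N - r := by
      have : N - 1 - r + 1 + r = N := by omega
      rw [eq_sub_iff_add_eq]
      exact_mod_cast this
    rw [hcast]
    rcases le_total (2 * (r : ℝ)) N with h | h
    · linarith [exp_neg_mul_sin_sq_le hN t (Nat.cast_nonneg r) h, hψ (N - r)]
    · have hrN : (r : ℝ) + 1 ≤ N := by exact_mod_cast hr'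
      have h2 := exp_neg_mul_sin_sq_le hN t (x := N - r) (by linarith) (by linarith)
      have h3 : Real.pi * ((N : ℝ) - r) / N = Real.pi - Real.pi * r / N := by field_simp
      rw [h3, Real.sin_pi_sub] at h2
      linarith [hψ r]
  have hsum1 : ∑ r ∈ Finset.range N, ψ ((r : ℝ) + 1) ≤ 2 / a := sum_inv_one_add_sq_le ha0 N
  have hsum2 : ∑ r ∈ Finset.range N, ψ r ≤ 1 + 2 / a := by
    have h1 : ∑ r ∈ Finset.range (N + 1), ψ r = ∑ r ∈ Finset.range N, ψ ((r : ℝ) + 1) + 1 := by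
      rw [Finset.sum_range_succ']
      simp [ψ]
    have h2 := Finset.sum_range_succ (fun r : ℕ ↦ ψ r) N
    linarith [hψ N]
  have hsum3 := Finset.sum_range_reflect (fun r : ℕ ↦ ψ ((r : ℝ) + 1)) N
  have h4 : 2 * N / t = 2 / a + 2 / a := by
    rw [ha]
    field_simp
    norm_num
  calc _ ≤ ∑ r ∈ Finset.range N, (ψ r + ψ (((N - 1 - r : ℕ) : ℝ) + 1)) := Finset.sum_le_sum hpt
    _ = ∑ r ∈ Finset.range N, ψ r + ∑ r ∈ Finset.range N, ψ ((r : ℝ) + 1) := by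
      rw [Finset.sum_add_distrib, hsum3]
    _ ≤ _ := by linarith

theorem sum_range_mul_of_periodic {f : ℕ → ℝ} {N : ℕ} (hf : Function.Periodic f N) (e : ℕ) :
    ∑ r ∈ Finset.range (e * N), f r = e * ∑ r ∈ Finset.range N, f r := by
  induction e with
  | zero => simp
  | succ e ih =>
    have h (x : ℕ) : f (e * N + x) = f x := by
      rw [add_comm]
      exact hf.nat_mul e x
    rw [add_mul, one_mul, Finset.sum_range_add, ih]
    simp only [h]
    push_cast
    ring

theorem sum_range_comp_mul_of_coprime {f : ℕ → ℝ} {N d : ℕ} (hN : 0 < N)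
    (hf : Function.Periodic f N) (hd : N.Coprime d) :
    ∑ r ∈ Finset.range N, f (d * r) = ∑ r ∈ Finset.range N, f r := by
  have hinj : Set.InjOn (fun r ↦ d * r % N) (Finset.range N : Set ℕ) := by
    intro x hx y hy hxy
    simp only [Finset.coe_range, Set.mem_Iio] at hx hy
    have h : x ≡ y [MOD N] := Nat.ModEq.cancel_left_of_coprime hd hxy
    exact h.eq_of_lt_of_lt hx hy
  have himage : (Finset.range N).image (fun r ↦ d * r % N) = Finset.range N := by
    apply Finset.eq_of_subset_of_card_le
    · intro x hx
      obtain ⟨r, -, rfl⟩ := Finset.mem_image.mp hx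
      exact Finset.mem_range.mpr (Nat.mod_lt _ hN)
    · rw [Finset.card_image_of_injOn hinj]
  conv_rhs => rw [← himage, Finset.sum_image hinj]
  simp only [hf.map_mod_nat]

theorem sum_exp_neg_mul_sin_sq_mul_le {M d : ℕ} (hM : 0 < M) (hd : 0 < d) {t : ℝ} (ht : 0 < t) :
    ∑ r ∈ Finset.range M, Real.exp (-(t ^ 2 * Real.sin (Real.pi * (d * r) / M) ^ 2))
      ≤ d + 2 * M / t := by
  obtain ⟨N, hMN⟩ := Nat.gcd_dvd_left M d
  obtain ⟨b, hdb⟩ := Nat.gcd_dvd_right M d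
  have he : 0 < M.gcd d := Nat.gcd_pos_of_pos_left d hM
  have hcop : N.Coprime b := by
    have := Nat.coprime_div_gcd_div_gcd he
    rwa [Nat.div_eq_of_eq_mul_right he hMN, Nat.div_eq_of_eq_mul_right he hdb] at this
  have hed : M.gcd d ≤ d := Nat.le_of_dvd hd (Nat.gcd_dvd_right M d)
  generalize M.gcd d = e at *
  have hN : 0 < N := Nat.pos_of_mul_pos_left (hMN ▸ hM)
  have hN' : (N : ℝ) ≠ 0 := by exact_mod_cast hN.ne'
  have he' : (e : ℝ) ≠ 0 := by exact_mod_cast he.ne'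
  let f : ℕ → ℝ := fun r ↦ Real.exp (-(t ^ 2 * Real.sin (Real.pi * r / N) ^ 2))
  have hf : Function.Periodic f N := by
    intro x
    have h : Real.pi * ((x + N : ℕ) : ℝ) / N = Real.pi * x / N + Real.pi := by
      push_cast
      field_simp
    simp only [f, h, Real.sin_add_pi, neg_sq]
  have hg : Function.Periodic (fun r ↦ f (b * r)) N := by
    intro x
    simp only [mul_add]
    exact hf.nat_mul b _
  have heq (r : ℕ) : Real.exp (-(t ^ 2 * Real.sin (Real.pi * (d * r) / M) ^ 2)) = f (b * r) := by
    have h : Real.pi * (d * r) / M = Real.pi * ((b * r : ℕ) : ℝ) / N := by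
      rw [hMN, hdb]
      push_cast
      field_simp
    simp only [f, h]
  simp only [heq]
  rw [show Finset.range M = Finset.range (e * N) by rw [hMN], sum_range_mul_of_periodic hg,
    sum_range_comp_mul_of_coprime hN hf hcop]
  calc (e : ℝ) * ∑ r ∈ Finset.range N, f r ≤ e * (1 + 2 * N / t) := by
        gcongr
        exact sum_exp_neg_mul_sin_sq_le hN ht
    _ = e + 2 * M / t := by
      rw [hMN]
      push_cast
      ring
    _ ≤ _ := by gcongr

theorem sum_prod_weight_mul {n k : ℕ} (p : Fin n → Fin k → ℝ) (hp : ∀ i, ∑ a, p i a = 1)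
    (i : Fin n) (u : Fin k → ℝ) :
    ∑ x : Fin n → Fin k, (∏ l, p l (x l)) * u (x i) = ∑ a, p i a * u a := by
  have h (x : Fin n → Fin k) : (∏ l, p l (x l)) * u (x i)
      = ∏ l, p l (x l) * (if l = i then u (x l) else 1) := by
    rw [Finset.prod_mul_distrib]
    simp
  simp only [h]
  rw [← Fintype.prod_sum (fun l a ↦ p l a * (if l = i then u a else 1)),
    Finset.prod_eq_single i _ (by simp)]
  · simp
  · intro l _ hl
    simp [hl, hp]

theorem sum_prod_weight_mul_mul {n k : ℕ} (p : Fin n → Fin k → ℝ) (u : Fin n → Fin k → ℝ)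
    (hu : ∀ i, ∑ a, p i a * u i a = 0) {i j : Fin n} (hij : i ≠ j) :
    ∑ x : Fin n → Fin k, (∏ l, p l (x l)) * (u i (x i) * u j (x j)) = 0 := by
  have h (x : Fin n → Fin k) : (∏ l, p l (x l)) * (u i (x i) * u j (x j))
      = ∏ l, p l (x l) * ((if l = i then u l (x l) else 1) * (if l = j then u l (x l) else 1)) := by
    rw [Finset.prod_mul_distrib, Finset.prod_mul_distrib]
    simp
  simp only [h]
  rw [← Fintype.prod_sum
    (fun l a ↦ p l a * ((if l = i then u l a else 1) * (if l = j then u l a else 1)))]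
  apply Finset.prod_eq_zero (Finset.mem_univ i)
  simp [hij, hu]

theorem hasSum_sum_ite_mul {ι : Type*} [Fintype ι] (w : ι → ℝ) (S : ι → ℕ) (f : ℕ → ℝ) :
    HasSum (fun t ↦ (∑ x, if S x = t then w x else 0) * f t) (∑ x, w x * f (S x)) := by
  simp only [Finset.sum_mul]
  refine hasSum_sum fun x _ ↦ ?_
  have h := hasSum_single (f := fun t ↦ (if S x = t then w x else 0) * f t) (S x) (by
    intro t ht
    simp [ht.symm])
  simpa using h

theorem hasSum_sum_ite_residue {ι : Type*} [Fintype ι] (w : ι → ℝ) (S : ι → ℕ) {M j : ℕ}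
    (hj : j < M) :
    HasSum (fun t ↦ ∑ x, if S x = j + M * t then w x else 0)
      (∑ x, if S x % M = j then w x else 0) := by
  refine hasSum_sum fun x _ ↦ ?_
  have hM : 0 < M := by omega
  by_cases h : S x % M = j
  · have hS : S x = j + M * (S x / M) := by rw [← h, Nat.mod_add_div]
    have h1 := hasSum_single (f := fun t ↦ if S x = j + M * t then w x else 0) (S x / M) (by
      intro t ht
      refine if_neg fun h' ↦ ht ?_
      exact (Nat.eq_of_mul_eq_mul_left hM (by omega)))
    simpa [h, ← hS] using h1
  · have h2 (t : ℕ) : ¬ S x = j + M * t := by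
      rintro h'
      apply h
      rw [h', Nat.add_mul_mod_self_left, Nat.mod_eq_of_lt hj]
    simp [h, h2, hasSum_zero]

theorem two_mul_distVar {n k : ℕ} (p : Fin n → Fin k → ℝ) (hp : ∀ i, ∑ a, p i a = 1) (P : ℕ → ℝ)
    (hP : ∀ t, P t = ∑ x : Fin n → Fin k, if ∑ i, (x i : ℕ) = t then ∏ i, p i (x i) else 0) :
    2 * distVar P = ∑ i, ∑ a, ∑ b, p i a * p i b * ((a : ℝ) - b) ^ 2 := by
  obtain rfl := funext hP
  set m : Fin n → ℝ := fun i ↦ ∑ a, p i a * (a : ℕ) with hm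
  have hmean : distMean (fun t ↦ ∑ x : Fin n → Fin k,
      if ∑ i, (x i : ℕ) = t then ∏ i, p i (x i) else 0) = ∑ i, m i := by
    rw [distMean, (hasSum_sum_ite_mul (fun x : Fin n → Fin k ↦ ∏ i, p i (x i))
      (fun x ↦ ∑ i, (x i : ℕ)) (fun t ↦ (t : ℝ))).tsum_eq]
    push_cast
    simp only [Finset.mul_sum]
    rw [Finset.sum_comm]
    exact Finset.sum_congr rfl fun i _ ↦ sum_prod_weight_mul p hp i (fun a ↦ (a : ℕ))
  have hu (i : Fin n) : ∑ a, p i a * ((a : ℕ) - m i) = 0 := by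
    simp only [mul_sub, Finset.sum_sub_distrib, ← Finset.sum_mul, hp, hm, one_mul, sub_self]
  rw [distVar, hmean, (hasSum_sum_ite_mul (fun x : Fin n → Fin k ↦ ∏ i, p i (x i))
      (fun x ↦ ∑ i, (x i : ℕ)) (fun t ↦ ((t : ℝ) - ∑ i, m i) ^ 2)).tsum_eq]
  push_cast
  have hvar : ∑ x : Fin n → Fin k, (∏ i, p i (x i)) * (∑ i, ((x i : ℕ) : ℝ) - ∑ i, m i) ^ 2
      = ∑ i, ∑ a, p i a * (((a : ℕ) - m i) * ((a : ℕ) - m i)) := by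
    simp only [← Finset.sum_sub_distrib, sq, Finset.sum_mul_sum]
    simp only [Finset.mul_sum]
    rw [Finset.sum_comm]
    refine Finset.sum_congr rfl fun i _ ↦ ?_
    rw [Finset.sum_comm, Finset.sum_eq_single i]
    · exact sum_prod_weight_mul p hp i (fun a ↦ ((a : ℕ) - m i) * ((a : ℕ) - m i))
    · intro j _ hj
      exact sum_prod_weight_mul_mul p (fun i a ↦ (a : ℕ) - m i) hu hj.symm
    · simp
  rw [hvar, Finset.mul_sum]
  refine Finset.sum_congr rfl fun i _ ↦ ?_
  have h2 (a b : Fin k) : p i a * p i b * ((a : ℝ) - b) ^ 2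
      = p i a * (((a : ℕ) - m i) * ((a : ℕ) - m i)) * p i b
        + p i a * (p i b * (((b : ℕ) - m i) * ((b : ℕ) - m i)))
        - 2 * (p i a * ((a : ℕ) - m i)) * (p i b * ((b : ℕ) - m i)) := by ring
  simp only [h2, Finset.sum_sub_distrib, Finset.sum_add_distrib, ← Finset.mul_sum, hu,
    ← Finset.sum_mul, hp]
  ring

theorem sum_stdAddChar_mul_natCast_sub {M : ℕ} [NeZero M] (x y : ℕ) :
    ∑ ξ : ZMod M, ZMod.stdAddChar (ξ * ((x : ZMod M) - (y : ZMod M)))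
      = if x % M = y % M then (M : ℂ) else 0 := by
  rw [AddChar.sum_mulShift _ (ZMod.isPrimitive_stdAddChar M), ZMod.card]
  have h : (x : ZMod M) - (y : ZMod M) = 0 ↔ x % M = y % M := by
    rw [sub_eq_zero, ZMod.natCast_eq_natCast_iff']
  split_ifs <;> simp_all

theorem sum_ite_mod_sq {ι : Type*} [Fintype ι] (w : ι → ℝ) (S : ι → ℕ) {M : ℕ} (hM : 0 < M) :
    ∑ j : Fin M, (∑ x, if S x % M = j then w x else 0) ^ 2
      = ∑ x, ∑ y, if S x % M = S y % M then w x * w y else 0 := by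
  simp only [sq, Finset.sum_mul_sum]
  rw [Finset.sum_comm]
  refine Finset.sum_congr rfl fun x _ ↦ ?_
  rw [Finset.sum_comm]
  refine Finset.sum_congr rfl fun y _ ↦ ?_
  rw [Finset.sum_eq_single (⟨S x % M, Nat.mod_lt _ hM⟩ : Fin M)]
  · simp [eq_comm]
  · intro j _ hj
    rw [if_neg, zero_mul]
    rintro h
    exact hj (Fin.ext h.symm)
  · simp

theorem normSq_sum_mul_stdAddChar {ι : Type*} [Fintype ι] (w : ι → ℝ) (S : ι → ℕ) {M : ℕ}
    [NeZero M] (ξ : ZMod M) :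
    Complex.normSq (∑ x, (w x : ℂ) * ZMod.stdAddChar (ξ * (S x : ZMod M)))
      = ∑ x, ∑ y, w x * w y *
        (ZMod.stdAddChar (ξ * ((S x : ZMod M) - (S y : ZMod M))) : ℂ).re := by
  rw [← Complex.ofReal_re (Complex.normSq _), ← Complex.mul_conj]
  simp only [map_sum, map_mul, Complex.conj_ofReal, Finset.sum_mul_sum,
    ← AddChar.map_neg_eq_conj, Complex.re_sum]
  refine Finset.sum_congr rfl fun x _ ↦ Finset.sum_congr rfl fun y _ ↦ ?_
  rw [← Complex.re_ofReal_mul, mul_sub, sub_eq_add_neg, AddChar.map_add_eq_mul]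
  congr 1
  push_cast
  ring

theorem mul_sum_residue_sq {ι : Type*} [Fintype ι] (w : ι → ℝ) (S : ι → ℕ) (M : ℕ) [NeZero M] :
    M * ∑ j : Fin M, (∑ x, if S x % M = j then w x else 0) ^ 2
      = ∑ ξ : ZMod M, Complex.normSq (∑ x, (w x : ℂ) * ZMod.stdAddChar (ξ * (S x : ZMod M))) := by
  rw [sum_ite_mod_sq w S (NeZero.pos M), Finset.mul_sum]
  simp only [normSq_sum_mul_stdAddChar]
  rw [Finset.sum_comm]
  refine Finset.sum_congr rfl fun x _ ↦ ?_
  rw [Finset.mul_sum, Finset.sum_comm]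
  refine Finset.sum_congr rfl fun y _ ↦ ?_
  rw [← Finset.mul_sum, ← Complex.re_sum, sum_stdAddChar_mul_natCast_sub]
  split_ifs
  · simp [mul_comm]
  · simp

theorem re_stdAddChar_mul_sub {M : ℕ} [NeZero M] (ξ : ZMod M) (a b : ℕ) :
    (ZMod.stdAddChar (ξ * ((a : ZMod M) - (b : ZMod M))) : ℂ).re
      = 1 - 2 * Real.sin (Real.pi * (((a : ℤ) - b).natAbs * ξ.val) / M) ^ 2 := by
  have h : ξ * ((a : ZMod M) - (b : ZMod M)) = ((ξ.val * ((a : ℤ) - b) : ℤ) : ZMod M) := by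
    push_cast
    simp
  have h2 : 2 * (Real.pi : ℂ) * Complex.I * ((ξ.val * ((a : ℤ) - b) : ℤ) : ℂ) / M
      = ((2 * (Real.pi * (((a : ℝ) - b) * ξ.val) / M) : ℝ) : ℂ) * Complex.I := by
    push_cast
    ring
  rw [h, ZMod.stdAddChar_coe, h2, Complex.exp_ofReal_mul_I_re, Real.cos_two_mul, Real.cos_sq',
    Nat.cast_natAbs]
  push_cast
  rcases abs_choice ((a : ℝ) - b) with h | h <;> rw [h]
  · ring
  · rw [show Real.pi * (-((a : ℝ) - b) * ξ.val) / M = -(Real.pi * (((a : ℝ) - b) * ξ.val) / M) by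
      ring, Real.sin_neg]
    ring

theorem normSq_sum_le_exp {M k : ℕ} [NeZero M] (q : Fin k → ℝ) (hq : ∑ a, q a = 1) (ξ : ZMod M) :
    Complex.normSq (∑ a, (q a : ℂ) * ZMod.stdAddChar (ξ * ((a : ℕ) : ZMod M)))
      ≤ Real.exp (-∑ a, ∑ b, q a * q b *
        (2 * Real.sin (Real.pi * (((a : ℤ) - b).natAbs * ξ.val) / M) ^ 2)) := by
  have h : Complex.normSq (∑ a, (q a : ℂ) * ZMod.stdAddChar (ξ * ((a : ℕ) : ZMod M)))
      = 1 - ∑ a, ∑ b, q a * q b *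
        (2 * Real.sin (Real.pi * (((a : ℤ) - b).natAbs * ξ.val) / M) ^ 2) := by
    have h1 : (1 : ℝ) = ∑ a, ∑ b, q a * q b := by rw [← Finset.sum_mul_sum, hq, one_mul]
    rw [h1, normSq_sum_mul_stdAddChar q (fun a ↦ (a : ℕ))]
    simp only [re_stdAddChar_mul_sub, mul_one_sub, Finset.sum_sub_distrib]
  rw [h]
  linarith [Real.add_one_le_exp (-∑ a, ∑ b, q a * q b *
        (2 * Real.sin (Real.pi * (((a : ℤ) - b).natAbs * ξ.val) / M) ^ 2))]

theorem _root_.AddChar.map_finset_sum {ι A R : Type*} [AddCommMonoid A] [CommMonoid R]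
    (χ : AddChar A R) (f : ι → A) (s : Finset ι) : χ (∑ i ∈ s, f i) = ∏ i ∈ s, χ (f i) :=
  map_prod χ.toMonoidHom (fun i ↦ Multiplicative.ofAdd (f i)) s

theorem normSq_sum_prod_le_exp {M n k : ℕ} [NeZero M] (p : Fin n → Fin k → ℝ)
    (hp : ∀ i, ∑ a, p i a = 1) (ξ : ZMod M) :
    Complex.normSq (∑ x : Fin n → Fin k,
        ((∏ i, p i (x i) : ℝ) : ℂ) * ZMod.stdAddChar (ξ * ((∑ i, (x i : ℕ) : ℕ) : ZMod M)))
      ≤ Real.exp (-∑ i, ∑ a, ∑ b, p i a * p i b *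
        (2 * Real.sin (Real.pi * (((a : ℤ) - b).natAbs * ξ.val) / M) ^ 2)) := by
  have h (x : Fin n → Fin k) :
      ((∏ i, p i (x i) : ℝ) : ℂ) * ZMod.stdAddChar (ξ * ((∑ i, (x i : ℕ) : ℕ) : ZMod M))
        = ∏ i, ((p i (x i) : ℂ) * ZMod.stdAddChar (ξ * ((x i : ℕ) : ZMod M))) := by
    push_cast
    rw [Finset.prod_mul_distrib, Finset.mul_sum, AddChar.map_finset_sum]
  simp only [h]
  rw [← Fintype.prod_sum (fun i a ↦ (p i a : ℂ) * ZMod.stdAddChar (ξ * ((a : ℕ) : ZMod M))),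
    map_prod, ← Finset.sum_neg_distrib, Real.exp_sum]
  exact Finset.prod_le_prod (fun _ _ ↦ Complex.normSq_nonneg _)
    fun i _ ↦ normSq_sum_le_exp (p i) (hp i) ξ

theorem sum_zmod_val_eq_sum_range (f : ℕ → ℝ) (M : ℕ) [NeZero M] :
    ∑ ξ : ZMod M, f ξ.val = ∑ r ∈ Finset.range M, f r := by
  obtain ⟨m, rfl⟩ := Nat.exists_eq_succ_of_ne_zero (NeZero.ne M)
  exact Fin.sum_univ_eq_sum_range f (m + 1)

theorem exp_neg_sum_le_sum_mul_exp {ι : Type*} [Fintype ι] {w : ι → ℝ} (hw : ∀ i, 0 ≤ w i)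
    (hw1 : ∑ i, w i = 1) (h : ι → ℝ) :
    Real.exp (-∑ i, w i * h i) ≤ ∑ i, w i * Real.exp (-h i) := by
  have := convexOn_exp.map_sum_le (t := Finset.univ) (w := w) (p := fun i ↦ -h i)
    (fun i _ ↦ hw i) hw1 (fun _ _ ↦ Set.mem_univ _)
  simpa using this

theorem sum_exp_neg_sum_sin_sq_le {ι : Type*} [Fintype ι] (w : ι → ℝ) (hw : ∀ i, 0 ≤ w i)
    (d : ι → ℕ) {k M : ℕ} (hd : ∀ i, d i ≤ k) {s : ℝ} (hs : 0 < s) (hM : s < M)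
    (hvar : ∑ i, w i * (d i : ℝ) ^ 2 = 2 * s ^ 2) :
    ∑ r ∈ Finset.range M,
        Real.exp (-∑ i, w i * (2 * Real.sin (Real.pi * (d i * r) / M) ^ 2))
      ≤ M * (8 * k / s) := by
  have hM0 : (0 : ℝ) < M := hs.trans hM
  have hM1 : 0 < M := by exact_mod_cast hM0
  let v : ι → ℝ := fun i ↦ w i * (d i : ℝ) ^ 2 / (2 * s ^ 2)
  have hv (i : ι) : 0 ≤ v i := by
    have := hw i
    positivity
  have hv1 : ∑ i, v i = 1 := by
    rw [← Finset.sum_div, hvar]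
    field_simp
  let h : ι → ℕ → ℝ := fun i r ↦ (2 * s / d i) ^ 2 * Real.sin (Real.pi * (d i * r) / M) ^ 2
  have hexp (r : ℕ) : ∑ i, w i * (2 * Real.sin (Real.pi * (d i * r) / M) ^ 2)
      = ∑ i, v i * h i r := by
    refine Finset.sum_congr rfl fun i _ ↦ ?_
    rcases eq_or_ne (d i : ℝ) 0 with h0 | h0
    · simp [v, h0]
    · simp only [v, h]
      field_simp
  have hsum (i : ι) : v i * ∑ r ∈ Finset.range M, Real.exp (-h i r) ≤ v i * (M * (8 * k / s)) := by
    rcases Nat.eq_zero_or_pos (d i) with h0 | h0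
    · simp [v, h0]
    · refine mul_le_mul_of_nonneg_left ?_ (hv i)
      have hd0 : (0 : ℝ) < d i := by exact_mod_cast h0
      have hdk : (d i : ℝ) ≤ k := by exact_mod_cast hd i
      refine (sum_exp_neg_mul_sin_sq_mul_le hM1 h0 (t := 2 * s / d i) (by positivity)).trans ?_
      calc (d i : ℝ) + 2 * M / (2 * s / d i) = (s + M) * d i / s := by field_simp
        _ ≤ (M + M) * k / s := by gcongr
        _ ≤ M * (8 * k / s) := by
          rw [← mul_div_assoc]
          refine div_le_div_of_nonneg_right ?_ hs.le
          nlinarith [mul_pos hM0 (hd0.trans_le hdk)]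
  calc _ ≤ ∑ r ∈ Finset.range M, ∑ i, v i * Real.exp (-h i r) := by
        simp only [hexp]
        exact Finset.sum_le_sum fun r _ ↦ exp_neg_sum_le_sum_mul_exp hv hv1 fun i ↦ h i r
    _ = ∑ i, v i * ∑ r ∈ Finset.range M, Real.exp (-h i r) := by
        rw [Finset.sum_comm]
        simp only [Finset.mul_sum]
    _ ≤ ∑ i, v i * (M * (8 * k / s)) := Finset.sum_le_sum fun i _ ↦ hsum i
    _ = M * (8 * k / s) := by rw [← Finset.sum_mul, hv1, one_mul]

/-- Any (n,k)-SIIRV reduced modulo `M` has small `L₂` norm: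
if `P ∈ S_{n,k}` has variance `s² > 0` and `M > s`, then the distribution `P'` of
`X mod M` for `X ∼ P` satisfies `Σ_{j<M} P'(j)² ≤ 8k/s` (i.e. `‖P'‖₂ ≤ √(8k/s)`). -/
theorem siirv_mod_M_l2_norm
    (n k : ℕ) (hn : 1 ≤ n) (hk : 2 ≤ k)
    (P : ℕ → ℝ) (hP : P ∈ SIIRVclass n k)
    (s : ℝ) (hs : 0 < s) (hvar : distVar P = s ^ 2)
    (M : ℕ) (hM : s < (M : ℝ)) :
    ∑ j : Fin M, (∑' t : ℕ, P ((j : ℕ) + M * t)) ^ 2 ≤ 8 * (k : ℝ) / s := by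
  obtain ⟨p, hp, hPp⟩ := hP
  have hp1 (i : Fin n) : ∑ a, p i a = 1 := (hp i).2
  have hM0 : (0 : ℝ) < M := hs.trans hM
  have : NeZero M := ⟨by rintro rfl; simp at hM0⟩
  have hresidue (j : Fin M) : ∑' t : ℕ, P (j + M * t)
      = ∑ x : Fin n → Fin k, if (∑ i, (x i : ℕ)) % M = j then ∏ i, p i (x i) else 0 := by
    simp only [hPp]
    exact (hasSum_sum_ite_residue _ (fun x : Fin n → Fin k ↦ ∑ i, (x i : ℕ)) j.2).tsum_eq
  simp only [hresidue]
  rw [← mul_le_mul_iff_right₀ hM0, mul_sum_residue_sq _ (fun x : Fin n → Fin k ↦ ∑ i, (x i : ℕ))]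
  let d : Fin n × Fin k × Fin k → ℕ := fun z ↦ ((z.2.1 : ℤ) - z.2.2).natAbs
  have hd (z : Fin n × Fin k × Fin k) : d z ≤ k := by
    have h1 := z.2.1.2
    have h2 := z.2.2.2
    simp only [d]
    omega
  have hdsq (z : Fin n × Fin k × Fin k) : (d z : ℝ) ^ 2 = ((z.2.1 : ℝ) - z.2.2) ^ 2 := by
    simp only [d, Nat.cast_natAbs]
    push_cast
    exact sq_abs _
  have hbound := sum_exp_neg_sum_sin_sq_le
    (fun z : Fin n × Fin k × Fin k ↦ p z.1 z.2.1 * p z.1 z.2.2)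
    (fun z ↦ mul_nonneg ((hp z.1).1 _) ((hp z.1).1 _)) d hd hs hM (by
      rw [← hvar, two_mul_distVar p hp1 P hPp]
      simp only [hdsq, Fintype.sum_prod_type])
  rw [← sum_zmod_val_eq_sum_range] at hbound
  refine le_trans (Finset.sum_le_sum fun ξ _ ↦ ?_) hbound
  simp only [Fintype.sum_prod_type]
  exact normSq_sum_prod_le_exp p hp1 ξ

end Stmt7
end

section
/- Let P be an (n,k)-SIIRV with standard deviation s = (Var_{X∼P}[X])^{1/2} > 0, let δ ∈ (0,1/2), and let M be a positive integer with M > s. Let P̂ be the DFT modulo M of P. Define L = { ξ ∈ {0,...,M-1} : there exist integers a, b with 0 ≤ a ≤ b < k, b ≥ 1, and |ξ/M − a/b| < √(ln(1/δ))/(2s) }. Then: (i) |P̂(ξ)| ≤ δ for every ξ ∈ {0,...,M-1} \ L, and |L| ≤ M·k²·√(log(1/δ))/s; (ii) at most 4·M·k·√(log(1/δ))/s values of ξ ∈ {0,...,M-1} satisfy |P̂(ξ)| > δ. -/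
open scoped BigOperators

namespace Stmt8

/-- The class of (n,k)-SIIRVs: distributions on `ℕ` of sums of `n` independent
random variables each taking values in `{0, 1, …, k-1}`. -/
def SIIRVclass (n k : ℕ) : Set (ℕ → ℝ) :=
  { P | ∃ p : Fin n → Fin k → ℝ,
      (∀ i, (∀ j, 0 ≤ p i j) ∧ ∑ j, p i j = 1) ∧
      ∀ t : ℕ,
        P t = ∑ x : Fin n → Fin k,
          (if (∑ i, ((x i : ℕ))) = t then ∏ i, p i (x i) else 0) }

/-- The mean of a distribution on `ℕ`. -/
noncomputable def distMean (P : ℕ → ℝ) : ℝ := ∑' j : ℕ, P j * (j : ℝ)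

/-- The variance of a distribution on `ℕ`. -/
noncomputable def distVar (P : ℕ → ℝ) : ℝ := ∑' j : ℕ, P j * ((j : ℝ) - distMean P) ^ 2

/-- The discrete Fourier transform modulo `M` of a distribution on `ℕ`. -/
noncomputable def dftN (M : ℕ) (P : ℕ → ℝ) (ξ : ℕ) : ℂ :=
  ∑' j : ℕ, (P j : ℂ) *
    Complex.exp (-(2 * (Real.pi : ℂ) * Complex.I * (ξ : ℂ) * (j : ℂ)) / (M : ℂ))

/-- The set `L` of frequencies close (modulo `M`) to a rational `a/b` with `0 ≤ a ≤ b < k`,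
`b ≥ 1`. -/
def Lset (M k : ℕ) (s δ : ℝ) : Set ℕ :=
  { ξ | ξ < M ∧ ∃ a b : ℕ, a ≤ b ∧ 1 ≤ b ∧ b < k ∧
      |(ξ : ℝ) / (M : ℝ) - (a : ℝ) / (b : ℝ)| < Real.sqrt (Real.log (1 / δ)) / (2 * s) }

section Counting

/-- The frequencies `ξ < M` for which `ξ / M` is within `η` of `c`. -/
noncomputable def nearFreq (M : ℕ) (η c : ℝ) : Finset ℕ :=
  (Finset.range M).filter (fun ξ => |(ξ : ℝ) / M - c| < η)

/-- The frequencies `ξ < M` for which `ξ / M` is within `η` of some `a / b`, `0 ≤ a ≤ b`. -/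
noncomputable def nearFrac (M : ℕ) (η : ℝ) (b : ℕ) : Finset ℕ :=
  (Finset.range (b + 1)).biUnion (fun a => nearFreq M η (a / b))

lemma mem_nearFrac {M : ℕ} {η : ℝ} {b ξ : ℕ} :
    ξ ∈ nearFrac M η b ↔
      ∃ a ≤ b, ξ < M ∧ |(ξ : ℝ) / M - (a : ℝ) / b| < η := by
  simp [nearFrac, nearFreq]

lemma card_le_of_sub_le (S : Finset ℕ) (w : ℝ) (hw : 0 ≤ w)
    (h : ∀ x ∈ S, ∀ y ∈ S, (y : ℝ) - x ≤ w) : (S.card : ℝ) ≤ w + 1 := by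
  rcases S.eq_empty_or_nonempty with rfl | hS
  · simp; linarith
  · have hsub : S ⊆ Finset.Icc (S.min' hS) (S.max' hS) := fun x hx =>
      Finset.mem_Icc.2 ⟨S.min'_le x hx, S.le_max' x hx⟩
    have hc := Finset.card_le_card hsub
    rw [Nat.card_Icc] at hc
    have hle : S.min' hS ≤ S.max' hS := S.min'_le _ (S.max'_mem hS)
    have hc' : S.card + S.min' hS ≤ S.max' hS + 1 := by omega
    have hc'' : (S.card : ℝ) + S.min' hS ≤ S.max' hS + 1 := by exact_mod_cast hc'
    have := h _ (S.min'_mem hS) _ (S.max'_mem hS)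
    linarith

lemma card_nearFreq_le {M : ℕ} (hM : 0 < M) {η : ℝ} (hη : 0 ≤ η) (c : ℝ) :
    ((nearFreq M η c).card : ℝ) ≤ 2 * η * M + 1 := by
  have hM' : (0 : ℝ) < M := by exact_mod_cast hM
  refine card_le_of_sub_le _ _ (by positivity) fun x hx y hy => ?_
  have hx' := abs_lt.1 (Finset.mem_filter.1 hx).2
  have hy' := abs_lt.1 (Finset.mem_filter.1 hy).2
  have h : ((y : ℝ) - x) / M ≤ 2 * η := by rw [sub_div]; linarith [hx'.1, hy'.2]
  exact (div_le_iff₀ hM').1 h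

lemma card_nearFrac_le {M : ℕ} {η C : ℝ} (hC : ∀ c, ((nearFreq M η c).card : ℝ) ≤ C) (b : ℕ) :
    ((nearFrac M η b).card : ℝ) ≤ (b + 1) * C := by
  calc ((nearFrac M η b).card : ℝ)
      ≤ ((∑ a ∈ Finset.range (b + 1), (nearFreq M η (a / b)).card : ℕ) : ℝ) := by
        exact_mod_cast Finset.card_biUnion_le
    _ ≤ ∑ _a ∈ Finset.range (b + 1), C := by
        push_cast
        exact Finset.sum_le_sum fun a _ => hC _
    _ = (b + 1) * C := by simp

lemma card_fractions_le {M : ℕ} {η C : ℝ} (hC : ∀ c, ((nearFreq M η c).card : ℝ) ≤ C) (k : ℕ) :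
    (((nearFreq M η 0 ∪ (Finset.range k).biUnion fun b =>
      (Finset.Icc 1 b).biUnion fun a => nearFreq M η (a / b)).card : ℕ) : ℝ) ≤
      (1 + (k : ℝ) * (k - 1) / 2) * C := by
  have hb : ∀ b : ℕ, ((((Finset.Icc 1 b).biUnion fun a : ℕ =>
      nearFreq M η (a / b)).card : ℕ) : ℝ) ≤ b * C := fun b => by
    calc _ ≤ ((∑ a ∈ Finset.Icc 1 b, (nearFreq M η (a / b)).card : ℕ) : ℝ) := by
          exact_mod_cast Finset.card_biUnion_le
      _ ≤ ∑ _a ∈ Finset.Icc 1 b, C := by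
          push_cast
          exact Finset.sum_le_sum fun a _ => hC _
      _ = b * C := by simp
  have hsum : ∀ m : ℕ, ∑ b ∈ Finset.range m, (b : ℝ) * C = (m : ℝ) * (m - 1) / 2 * C := by
    intro m
    induction m with
    | zero => simp
    | succ m ih => rw [Finset.sum_range_succ, ih]; push_cast; ring
  have hU : ((((Finset.range k).biUnion fun b : ℕ =>
      (Finset.Icc 1 b).biUnion fun a : ℕ => nearFreq M η (a / b)).card : ℕ) : ℝ) ≤
      (k : ℝ) * (k - 1) / 2 * C := by
    rw [← hsum]
    calc _ ≤ ((∑ b ∈ Finset.range k, ((Finset.Icc 1 b).biUnion fun a : ℕ =>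
              nearFreq M η (a / b)).card : ℕ) : ℝ) := by
          exact_mod_cast Finset.card_biUnion_le
      _ ≤ _ := by
          push_cast
          exact Finset.sum_le_sum fun b _ => hb b
  have h0 := hC 0
  have := Finset.card_union_le (nearFreq M η 0) ((Finset.range k).biUnion fun b : ℕ =>
      (Finset.Icc 1 b).biUnion fun a : ℕ => nearFreq M η (a / b))
  have : (((nearFreq M η 0 ∪ (Finset.range k).biUnion fun b =>
      (Finset.Icc 1 b).biUnion fun a => nearFreq M η (a / b)).card : ℕ) : ℝ) ≤ _ :=
    Nat.cast_le.2 this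
  push_cast at this
  linarith

/-- Off the frequencies near fractions of denominator `|d|`, the multiple `ξ d / M` is at
distance at least `|d| η` from the integers. -/
lemma le_sub_round_sq {M ξ : ℕ} (hξ : ξ < M) {η : ℝ} (hη : 0 < η) {d : ℤ} (hd : d ≠ 0)
    (h : ξ ∉ nearFrac M η d.natAbs) :
    η ^ 2 * (d : ℝ) ^ 2 ≤ ((ξ : ℝ) / M * d - round ((ξ : ℝ) / M * d)) ^ 2 := by
  set y : ℝ := (ξ : ℝ) / M with hy
  have hM' : (0 : ℝ) < M := by exact_mod_cast (Nat.zero_le ξ).trans_lt hξ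
  have hy0 : 0 ≤ y := by positivity
  have hy1 : y < 1 := by rw [hy, div_lt_one hM']; exact_mod_cast hξ
  by_contra! hlt
  have habs : |y * d - round (y * d)| < η * |(d : ℝ)| := by
    rw [← sq_abs (d : ℝ), ← mul_pow] at hlt
    exact abs_lt_of_sq_lt_sq hlt (by positivity)
  have hhalf := abs_sub_round (y * (d : ℝ))
  obtain ⟨b, hb⟩ : ∃ b : ℕ, b = d.natAbs := ⟨_, rfl⟩
  have hbpos : 0 < b := by omega
  have hbR : (0 : ℝ) < b := by exact_mod_cast hbpos
  obtain ⟨m, hm1, hm2⟩ : ∃ m : ℤ, |y * b - m| < η * b ∧ |y * b - m| ≤ 1 / 2 := by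
    rcases Int.natAbs_eq d with hdb | hdb
    · rw [← hb] at hdb
      have hdR : (d : ℝ) = b := by rw [hdb]; simp
      rw [hdR] at habs hhalf
      rw [abs_of_pos hbR] at habs
      exact ⟨_, habs, hhalf⟩
    · rw [← hb] at hdb
      have hdR : (d : ℝ) = -b := by rw [hdb]; simp
      rw [hdR] at habs hhalf
      rw [abs_neg, abs_of_pos hbR] at habs
      have he : |y * b - ((-round (y * -(b : ℝ)) : ℤ) : ℝ)| =
          |y * -(b : ℝ) - round (y * -(b : ℝ))| := by
        rw [← abs_neg]
        congr 1
        push_cast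
        ring
      exact ⟨-round (y * -(b : ℝ)), he ▸ habs, he ▸ hhalf⟩
  have hm2' := abs_le.1 hm2
  have hyb : y * b < b := by nlinarith
  have hyb0 : 0 ≤ y * b := by positivity
  have hm0 : 0 ≤ m := by
    have : (-1 : ℝ) < m := by linarith [hm2'.2]
    have : (-1 : ℤ) < m := by exact_mod_cast this
    omega
  have hmb : m ≤ b := by
    have : (m : ℝ) < b + 1 := by linarith [hm2'.1]
    have : m < b + 1 := by exact_mod_cast this
    omega
  obtain ⟨a, rfl⟩ := Int.eq_ofNat_of_zero_le hm0
  refine h (mem_nearFrac.2 ⟨a, by omega, hξ, ?_⟩)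
  rw [← hb, ← hy]
  have : y - (a : ℝ) / b = (y * b - (a : ℤ)) / b := by
    push_cast; field_simp
  rw [this, abs_div, abs_of_pos hbR, div_lt_iff₀ hbR]
  exact hm1

end Counting

section Difference

variable {n k : ℕ}

/-- The sum over `i` of the expectations of `g (X_i - Y_i)`, where `X_i`, `Y_i` are independent
with distribution `p i`. -/
def diffSum (p : Fin n → Fin k → ℝ) (g : ℤ → ℝ) : ℝ :=
  ∑ i, ∑ j, ∑ l, p i j * p i l * g ((j : ℕ) - (l : ℕ) : ℤ)

lemma diffSum_mono {p : Fin n → Fin k → ℝ} (hp : ∀ i j, 0 ≤ p i j) {g h : ℤ → ℝ}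
    (hgh : ∀ d : ℤ, d.natAbs < k → g d ≤ h d) : diffSum p g ≤ diffSum p h := by
  refine Finset.sum_le_sum fun i _ => Finset.sum_le_sum fun j _ => Finset.sum_le_sum fun l _ => ?_
  exact mul_le_mul_of_nonneg_left (hgh _ (by omega)) (mul_nonneg (hp i j) (hp i l))

lemma diffSum_const_mul (p : Fin n → Fin k → ℝ) (c : ℝ) (g : ℤ → ℝ) :
    diffSum p (fun d => c * g d) = c * diffSum p g := by
  simp only [diffSum, Finset.mul_sum]
  exact Finset.sum_congr rfl fun i _ => Finset.sum_congr rfl fun j _ =>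
    Finset.sum_congr rfl fun l _ => by ring

lemma diffSum_add (p : Fin n → Fin k → ℝ) (g h : ℤ → ℝ) :
    diffSum p (fun d => g d + h d) = diffSum p g + diffSum p h := by
  simp only [diffSum, mul_add, Finset.sum_add_distrib]

lemma diffSum_sum (p : Fin n → Fin k → ℝ) {α : Type*} (S : Finset α) (g : α → ℤ → ℝ) :
    diffSum p (fun d => ∑ x ∈ S, g x d) = ∑ x ∈ S, diffSum p (g x) := by
  classical
  induction S using Finset.induction_on with
  | empty => simp [diffSum]
  | insert a S ha ih => simp only [Finset.sum_insert ha, diffSum_add, ih]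

end Difference

section Product

variable {n k : ℕ} {p : Fin n → Fin k → ℝ} {P : ℕ → ℝ}

lemma tsum_siirv_smul {E : Type*} [NormedAddCommGroup E] [NormedSpace ℝ E]
    (hP : ∀ t : ℕ, P t = ∑ x : Fin n → Fin k,
      (if (∑ i, ((x i : ℕ))) = t then ∏ i, p i (x i) else 0)) (f : ℕ → E) :
    ∑' t, P t • f t = ∑ x : Fin n → Fin k, (∏ i, p i (x i)) • f (∑ i, (x i : ℕ)) := by
  have h1 : ∀ t, P t • f t = ∑ x : Fin n → Fin k,
      (if t = (∑ i, ((x i : ℕ))) then (∏ i, p i (x i)) • f (∑ i, (x i : ℕ)) else 0) := by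
    intro t
    rw [hP, Finset.sum_smul]
    refine Finset.sum_congr rfl fun x _ => ?_
    by_cases h : ∑ i, ((x i : ℕ)) = t
    · simp [h]
    · rw [if_neg h, if_neg (Ne.symm h), zero_smul]
  have h2 : ∀ x : Fin n → Fin k, HasSum (fun t : ℕ =>
      if t = (∑ i, ((x i : ℕ))) then (∏ i, p i (x i)) • f (∑ i, (x i : ℕ)) else 0)
      ((∏ i, p i (x i)) • f (∑ i, (x i : ℕ))) := fun x =>
    hasSum_ite_eq (∑ i, (x i : ℕ)) ((∏ i, p i (x i)) • f (∑ i, (x i : ℕ)))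
  rw [tsum_congr h1]
  exact (hasSum_sum fun x _ => h2 x).tsum_eq

lemma sum_prod_mul_prod {R : Type*} [CommRing R] (p g : Fin n → Fin k → R) :
    ∑ x : Fin n → Fin k, (∏ i, p i (x i)) * ∏ i, g i (x i) = ∏ i, ∑ j, p i j * g i j := by
  rw [Finset.prod_univ_sum, Fintype.piFinset_univ]
  simp_rw [Finset.prod_mul_distrib]

lemma sum_prod_mul_apply (hp1 : ∀ i, ∑ j, p i j = 1) (a : Fin n) (f : Fin k → ℝ) :
    ∑ x : Fin n → Fin k, (∏ i, p i (x i)) * f (x a) = ∑ j, p a j * f j := by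
  have h := sum_prod_mul_prod p (fun i j => if i = a then f j else 1)
  simp only [Finset.prod_ite_eq', Finset.mem_univ, if_true] at h
  rw [h, Finset.prod_eq_single a]
  · simp
  · intro i _ hi; simp [hi, hp1]
  · simp

lemma sum_prod_mul_apply_mul_apply {a b : Fin n} (hab : a ≠ b)
    (f g : Fin k → ℝ) (hf : ∑ j, p a j * f j = 0) :
    ∑ x : Fin n → Fin k, (∏ i, p i (x i)) * (f (x a) * g (x b)) = 0 := by
  have h := sum_prod_mul_prod p
    (fun i j => (if i = a then f j else 1) * (if i = b then g j else 1))
  simp only [Finset.prod_mul_distrib, Finset.prod_ite_eq', Finset.mem_univ, if_true] at h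
  rw [h]
  refine Finset.prod_eq_zero (Finset.mem_univ a) ?_
  simpa [hab] using hf

lemma two_mul_variance (q : Fin k → ℝ) (hq : ∑ j, q j = 1) (f : Fin k → ℝ) :
    ∑ j, ∑ l, q j * q l * (f j - f l) ^ 2 =
      2 * ∑ j, q j * (f j - ∑ l, q l * f l) ^ 2 := by
  set m := ∑ l, q l * f l with hm
  have hL : ∀ j, ∑ l, q j * q l * (f j - f l) ^ 2 =
      q j * f j ^ 2 - 2 * (q j * f j) * m + q j * ∑ l, q l * f l ^ 2 := by
    intro j
    have : ∀ l, q j * q l * (f j - f l) ^ 2 =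
        (q j * f j ^ 2) * q l - (2 * (q j * f j)) * (q l * f l) + q j * (q l * f l ^ 2) :=
      fun l => by ring
    simp_rw [this, Finset.sum_add_distrib, Finset.sum_sub_distrib, ← Finset.mul_sum, hq, ← hm]
    ring
  have hR : ∀ j, q j * (f j - m) ^ 2 = q j * f j ^ 2 - (2 * m) * (q j * f j) + m ^ 2 * q j :=
    fun j => by ring
  simp_rw [hL, hR, Finset.sum_add_distrib, Finset.sum_sub_distrib, ← Finset.sum_mul,
    ← Finset.mul_sum, hq, ← hm]
  ring

lemma diffSum_sq (hp1 : ∀ i, ∑ j, p i j = 1)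
    (hP : ∀ t : ℕ, P t = ∑ x : Fin n → Fin k,
      (if (∑ i, ((x i : ℕ))) = t then ∏ i, p i (x i) else 0)) :
    diffSum p (fun d => (d : ℝ) ^ 2) = 2 * distVar P := by
  set m : Fin n → ℝ := fun i => ∑ j, p i j * ((j : ℕ) : ℝ) with hm
  have hmean : distMean P = ∑ i, m i := by
    have h := tsum_siirv_smul hP (fun t => (t : ℝ))
    simp only [smul_eq_mul] at h
    rw [distMean, h]
    push_cast
    simp_rw [Finset.mul_sum]
    rw [Finset.sum_comm]
    exact Finset.sum_congr rfl fun i _ => sum_prod_mul_apply hp1 i (fun j => ((j : ℕ) : ℝ))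
  have hvar : distVar P = ∑ i, ∑ j, p i j * (((j : ℕ) : ℝ) - m i) ^ 2 := by
    have h := tsum_siirv_smul hP (fun t => ((t : ℝ) - distMean P) ^ 2)
    simp only [smul_eq_mul] at h
    rw [distVar, h, hmean]
    push_cast
    simp_rw [← Finset.sum_sub_distrib, sq, Finset.sum_mul_sum, Finset.mul_sum]
    rw [Finset.sum_comm]
    refine Finset.sum_congr rfl fun a _ => ?_
    rw [Finset.sum_comm, Finset.sum_eq_single a]
    · exact sum_prod_mul_apply hp1 a
        (fun j => (((j : ℕ) : ℝ) - m a) * (((j : ℕ) : ℝ) - m a))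
    · intro b _ hba
      refine sum_prod_mul_apply_mul_apply hba.symm
        (fun j => (((j : ℕ) : ℝ) - m a)) (fun j => (((j : ℕ) : ℝ) - m b)) ?_
      simp_rw [mul_sub, Finset.sum_sub_distrib, ← Finset.sum_mul, hp1, hm]
      ring
    · simp
  rw [hvar, Finset.mul_sum, diffSum]
  refine Finset.sum_congr rfl fun i _ => ?_
  rw [← two_mul_variance (p i) (hp1 i) (fun j => ((j : ℕ) : ℝ))]
  push_cast
  rfl

lemma dftN_eq_prod (M ξ : ℕ)
    (hP : ∀ t : ℕ, P t = ∑ x : Fin n → Fin k,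
      (if (∑ i, ((x i : ℕ))) = t then ∏ i, p i (x i) else 0)) :
    dftN M P ξ = ∏ i, ∑ j, (p i j : ℂ) *
      Complex.exp ((-(2 * Real.pi * (ξ / M : ℝ) * (j : ℕ)) : ℝ) * Complex.I) := by
  have h := tsum_siirv_smul hP (fun t : ℕ =>
    Complex.exp (-(2 * (Real.pi : ℂ) * Complex.I * (ξ : ℂ) * (t : ℂ)) / (M : ℂ)))
  simp only [Complex.real_smul] at h
  rw [dftN, h, ← sum_prod_mul_prod]
  refine Finset.sum_congr rfl fun x _ => ?_
  push_cast
  rw [← Complex.exp_sum]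
  congr 2
  rw [Finset.mul_sum, ← Finset.sum_neg_distrib, Finset.sum_div]
  refine Finset.sum_congr rfl fun i _ => ?_
  ring

lemma norm_sq_sum_mul_exp (q θ : Fin k → ℝ) :
    ‖∑ j, (q j : ℂ) * Complex.exp ((θ j : ℝ) * Complex.I)‖ ^ 2 =
      ∑ j, ∑ l, q j * q l * Real.cos (θ j - θ l) := by
  have hre : (∑ j, (q j : ℂ) * Complex.exp ((θ j : ℝ) * Complex.I)).re =
      ∑ j, q j * Real.cos (θ j) := by
    simp [Complex.exp_ofReal_mul_I_re]
  have him : (∑ j, (q j : ℂ) * Complex.exp ((θ j : ℝ) * Complex.I)).im =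
      ∑ j, q j * Real.sin (θ j) := by
    simp [Complex.exp_ofReal_mul_I_im]
  rw [← Complex.normSq_eq_norm_sq, Complex.normSq_apply, hre, him, Finset.sum_mul_sum,
    Finset.sum_mul_sum, ← Finset.sum_add_distrib]
  refine Finset.sum_congr rfl fun j _ => ?_
  rw [← Finset.sum_add_distrib]
  refine Finset.sum_congr rfl fun l _ => ?_
  rw [Real.cos_sub]; ring

lemma cos_two_pi_mul_le (y : ℝ) :
    Real.cos (2 * Real.pi * y) ≤ 1 - 8 * (y - round y) ^ 2 := by
  have h1 : Real.cos (2 * Real.pi * y) = Real.cos (2 * Real.pi * (y - round y)) := by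
    rw [← Real.cos_sub_int_mul_two_pi _ (round y)]
    congr 1; ring
  have hb : |2 * Real.pi * (y - round y)| ≤ Real.pi := by
    rw [abs_mul, abs_of_pos Real.two_pi_pos]
    nlinarith [abs_sub_round y, Real.pi_pos]
  have h2 := Real.cos_le_one_sub_mul_cos_sq hb
  rw [h1]
  refine h2.trans (le_of_eq ?_)
  field_simp [Real.pi_ne_zero]
  ring

lemma norm_dftN_sq_le (hp : ∀ i j, 0 ≤ p i j) (hp1 : ∀ i, ∑ j, p i j = 1)
    (hP : ∀ t : ℕ, P t = ∑ x : Fin n → Fin k,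
      (if (∑ i, ((x i : ℕ))) = t then ∏ i, p i (x i) else 0)) (M ξ : ℕ) :
    ‖dftN M P ξ‖ ^ 2 ≤ Real.exp (-8 * diffSum p
      (fun d => ((ξ : ℝ) / M * d - round ((ξ : ℝ) / M * d)) ^ 2)) := by
  rw [dftN_eq_prod M ξ hP, norm_prod, ← Finset.prod_pow, diffSum, Finset.mul_sum, Real.exp_sum]
  refine Finset.prod_le_prod (fun i _ => by positivity) fun i _ => ?_
  rw [norm_sq_sum_mul_exp]
  refine le_trans ?_ (Real.add_one_le_exp _)
  have h1 : (1 : ℝ) = ∑ j, ∑ l, p i j * p i l := by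
    simp_rw [← Finset.mul_sum, hp1, mul_one, hp1]
  rw [Finset.mul_sum]
  conv_rhs => rw [h1]
  rw [← Finset.sum_add_distrib]
  refine Finset.sum_le_sum fun j _ => ?_
  rw [Finset.mul_sum, ← Finset.sum_add_distrib]
  refine Finset.sum_le_sum fun l _ => ?_
  have hc := cos_two_pi_mul_le ((ξ : ℝ) / M * (((j : ℕ) - (l : ℕ) : ℤ) : ℝ))
  have he : Real.cos (-(2 * Real.pi * ((ξ : ℝ) / M) * (j : ℕ)) -
      -(2 * Real.pi * ((ξ : ℝ) / M) * (l : ℕ))) =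
      Real.cos (2 * Real.pi * ((ξ : ℝ) / M * (((j : ℕ) - (l : ℕ) : ℤ) : ℝ))) := by
    rw [← Real.cos_neg]
    congr 1
    push_cast
    ring
  rw [he]
  nlinarith [mul_le_mul_of_nonneg_left hc (mul_nonneg (hp i j) (hp i l))]

end Product

/-- Effective Fourier support of SIIRVs: for an (n,k)-SIIRV `P` with standard deviation
`s > 0`, `δ ∈ (0,1/2)`, and `M > s`: (i) `|P̂(ξ)| ≤ δ` off `L`, and
`|L| ≤ M k² √(log(1/δ))/s`; (ii) at most `4Mk√(log(1/δ))/s` frequencies `ξ < M`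
have `|P̂(ξ)| > δ`. -/
theorem siirv_fourier_support
    (n k : ℕ) (hn : 1 ≤ n) (hk : 2 ≤ k)
    (P : ℕ → ℝ) (hP : P ∈ SIIRVclass n k)
    (s : ℝ) (hs : 0 < s) (hvar : distVar P = s ^ 2)
    (δ : ℝ) (hδ0 : 0 < δ) (hδ : δ < 1 / 2)
    (M : ℕ) (hM : s < (M : ℝ)) :
    (∀ ξ : ℕ, ξ < M → ξ ∉ Lset M k s δ → ‖dftN M P ξ‖ ≤ δ) ∧
    ((Lset M k s δ).ncard : ℝ) ≤
      (M : ℝ) * (k : ℝ) ^ 2 * Real.sqrt (Real.logb 2 (1 / δ)) / s ∧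
    (({ξ : ℕ | ξ < M ∧ δ < ‖dftN M P ξ‖}.ncard : ℝ) ≤
      4 * (M : ℝ) * (k : ℝ) * Real.sqrt (Real.logb 2 (1 / δ)) / s) := by
  obtain ⟨p, hp, hPt⟩ := hP
  have hp0 : ∀ i j, 0 ≤ p i j := fun i => (hp i).1
  have hp1 : ∀ i, ∑ j, p i j = 1 := fun i => (hp i).2
  have hM0 : 0 < M := by exact_mod_cast hs.trans hM
  have hMR : (0 : ℝ) < M := by exact_mod_cast hM0
  have h2δ : 2 ≤ 1 / δ := by rw [le_div_iff₀ hδ0]; linarith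
  have hlog : 0 < Real.log (1 / δ) := Real.log_pos (by linarith)
  set η : ℝ := Real.sqrt (Real.log (1 / δ)) / (2 * s) with hη
  have hη0 : 0 < η := div_pos (Real.sqrt_pos.2 hlog) (by positivity)
  have hηs : s ^ 2 * η ^ 2 = Real.log (1 / δ) / 4 := by
    rw [hη, div_pow, Real.sq_sqrt hlog.le]; field_simp; ring
  set R : ℝ := M * Real.sqrt (Real.logb 2 (1 / δ)) / s with hR
  have hln2 : Real.log 2 ≤ 1 := by linarith [Real.log_two_lt_d9]
  have hlogb : Real.log (1 / δ) ≤ Real.logb 2 (1 / δ) :=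
    le_div_self hlog.le (Real.log_pos one_lt_two) hln2
  have hlogb1 : 1 ≤ Real.logb 2 (1 / δ) := by
    rw [Real.le_logb_iff_rpow_le one_lt_two (by positivity)]; simpa using h2δ
  have hR1 : 1 ≤ R := by
    rw [hR, le_div_iff₀ hs, one_mul]
    have : 1 ≤ Real.sqrt (Real.logb 2 (1 / δ)) := Real.one_le_sqrt.2 hlogb1
    nlinarith
  have hWR : 2 * η * M ≤ R := by
    have : 2 * η * M = M * Real.sqrt (Real.log (1 / δ)) / s := by rw [hη]; field_simp
    rw [this, hR]
    gcongr
  have hC : ∀ c, ((nearFreq M η c).card : ℝ) ≤ 2 * R := fun c =>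
    (card_nearFreq_le hM0 hη0.le c).trans (by linarith)
  have hD2 : diffSum p (fun d => (d : ℝ) ^ 2) = 2 * s ^ 2 := by
    rw [diffSum_sq hp1 hPt, hvar]
  have hsmall : ∀ ξ : ℕ, δ < ‖dftN M P ξ‖ →
      diffSum p (fun d => ((ξ : ℝ) / M * d - round ((ξ : ℝ) / M * d)) ^ 2) < s ^ 2 * η ^ 2 := by
    intro ξ hξ
    have h1 : δ ^ 2 < Real.exp (-8 * diffSum p
        (fun d => ((ξ : ℝ) / M * d - round ((ξ : ℝ) / M * d)) ^ 2)) :=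
      lt_of_lt_of_le (by gcongr) (norm_dftN_sq_le hp0 hp1 hPt M ξ)
    have h2 := (Real.log_lt_iff_lt_exp (by positivity)).2 h1
    rw [Real.log_pow] at h2
    rw [hηs, one_div, Real.log_inv]
    push_cast at h2
    linarith
  have hk1 : (2 : ℝ) ≤ k := by exact_mod_cast hk
  refine ⟨fun ξ hξM hξL => ?_, ?_, ?_⟩
  · by_contra! hlt
    have h1 := hsmall ξ hlt
    have h2 : diffSum p (fun d => η ^ 2 * (d : ℝ) ^ 2) ≤
        diffSum p (fun d => ((ξ : ℝ) / M * d - round ((ξ : ℝ) / M * d)) ^ 2) := by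
      refine diffSum_mono hp0 fun d hdk => ?_
      rcases eq_or_ne d 0 with rfl | hd
      · simp
      · refine le_sub_round_sq hξM hη0 hd fun hmem => hξL ?_
        obtain ⟨a, hab, hξ, h⟩ := mem_nearFrac.1 hmem
        exact ⟨hξ, a, d.natAbs, hab, by omega, hdk, h⟩
    rw [diffSum_const_mul, hD2] at h2
    have : 0 < s ^ 2 * η ^ 2 := by positivity
    linarith
  · have hsub : Lset M k s δ ⊆ ((nearFreq M η 0 ∪ (Finset.range k).biUnion fun b =>
        (Finset.Icc 1 b).biUnion fun a => nearFreq M η (a / b) : Finset ℕ) : Set ℕ) := by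
      rintro ξ ⟨hξ, a, b, hab, hb1, hbk, h⟩
      simp only [Finset.mem_coe, Finset.mem_union, Finset.mem_biUnion, Finset.mem_range,
        Finset.mem_Icc, nearFreq, Finset.mem_filter]
      rcases Nat.eq_zero_or_pos a with rfl | ha
      · left
        refine ⟨hξ, ?_⟩
        rwa [Nat.cast_zero, zero_div] at h
      · exact Or.inr ⟨b, hbk, a, ⟨ha, hab⟩, hξ, h⟩
    have h1 := Set.ncard_le_ncard hsub (Finset.finite_toSet _)
    rw [Set.ncard_coe_finset] at h1
    have h2 := (Nat.cast_le (α := ℝ).2 h1).trans (card_fractions_le hC k)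
    have h3 : (M : ℝ) * (k : ℝ) ^ 2 * Real.sqrt (Real.logb 2 (1 / δ)) / s = k ^ 2 * R := by
      rw [hR]; ring
    rw [h3]
    nlinarith
  · classical
    set B : Finset ℕ := (Finset.range M).filter (fun ξ => δ < ‖dftN M P ξ‖) with hB
    have hBeq : {ξ : ℕ | ξ < M ∧ δ < ‖dftN M P ξ‖} = (B : Set ℕ) := by
      ext ξ; simp [hB]
    have h3 : 4 * (M : ℝ) * (k : ℝ) * Real.sqrt (Real.logb 2 (1 / δ)) / s = 4 * k * R := by
      rw [hR]; ring
    rw [hBeq, Set.ncard_coe_finset, h3]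
    have hlow : ∀ ξ ∈ B, s ^ 2 ≤ diffSum p
        (fun d => if ξ ∈ nearFrac M η d.natAbs then (d : ℝ) ^ 2 else 0) := by
      intro ξ hξ
      obtain ⟨hξM, hξδ⟩ := Finset.mem_filter.1 hξ
      have h1 := hsmall ξ hξδ
      have h2 : diffSum p (fun d => η ^ 2 * (d : ℝ) ^ 2) ≤
          diffSum p (fun d => η ^ 2 * (if ξ ∈ nearFrac M η d.natAbs then (d : ℝ) ^ 2 else 0) +
            ((ξ : ℝ) / M * d - round ((ξ : ℝ) / M * d)) ^ 2) := by
        refine diffSum_mono hp0 fun d _ => ?_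
        by_cases hmem : ξ ∈ nearFrac M η d.natAbs
        · rw [if_pos hmem]
          exact le_add_of_nonneg_right (sq_nonneg _)
        · rw [if_neg hmem, mul_zero, zero_add]
          rcases eq_or_ne d 0 with rfl | hd
          · simp
          · exact le_sub_round_sq (Finset.mem_range.1 hξM) hη0 hd hmem
      rw [diffSum_add, diffSum_const_mul, diffSum_const_mul, hD2] at h2
      have hη2 : 0 < η ^ 2 := by positivity
      refine le_of_mul_le_mul_left ?_ hη2
      linarith
    have hup : ∑ ξ ∈ B, diffSum p
        (fun d => if ξ ∈ nearFrac M η d.natAbs then (d : ℝ) ^ 2 else 0) ≤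
        (k * (2 * R)) * (2 * s ^ 2) := by
      rw [← diffSum_sum, ← hD2, ← diffSum_const_mul]
      refine diffSum_mono hp0 fun d hd => ?_
      rw [← Finset.sum_filter, Finset.sum_const, nsmul_eq_mul]
      refine mul_le_mul_of_nonneg_right ?_ (sq_nonneg _)
      have hsub : B.filter (fun ξ => ξ ∈ nearFrac M η d.natAbs) ⊆ nearFrac M η d.natAbs :=
        fun ξ hξ => (Finset.mem_filter.1 hξ).2
      refine (Nat.cast_le.2 (Finset.card_le_card hsub)).trans
        ((card_nearFrac_le hC d.natAbs).trans ?_)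
      have : ((d.natAbs : ℕ) : ℝ) + 1 ≤ k := by exact_mod_cast hd
      gcongr
    have hsum := (Finset.card_nsmul_le_sum B _ _ hlow).trans hup
    rw [nsmul_eq_mul] at hsum
    have hs2 : 0 < s ^ 2 := by positivity
    refine le_of_mul_le_mul_right ?_ hs2
    linarith

end Stmt8
end

section
/- Let r ≥ 1 be an integer, m > 0, let P be a probability distribution on {1,...,r} and q : {1,...,r} → ℝ any function. Let X_1,...,X_r be independent random variables with X_i distributed as Poisson(m·P(i)), and set Z = Σ_{i=1}^r ((X_i − m·q(i))² − X_i). Then E[Z] = m²·Σ_{i=1}^r (P(i) − q(i))², and Var[Z] = Σ_{i=1}^r ( 4·m³·(P(i) − q(i))²·P(i) + 2·m²·P(i)² ). -/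
open scoped BigOperators

namespace Stmt10

/-- The probability mass function of the Poisson distribution with mean `lam`. -/
noncomputable def poissonP (lam : ℝ) (n : ℕ) : ℝ :=
  Real.exp (-lam) * lam ^ n / (n.factorial : ℝ)

open MeasureTheory ProbabilityTheory

/-- The `k`-th factorial moment of the Poisson distribution. -/
lemma hasSum_poissonP_mul_descFactorial (lam : ℝ) (k : ℕ) :
    HasSum (fun n ↦ poissonP lam n * (n.descFactorial k : ℝ)) (lam ^ k) := by
  rw [← (add_left_injective k).hasSum_iff]
  · have h := (NormedSpace.expSeries_div_hasSum_exp lam).mul_left (Real.exp (-lam) * lam ^ k)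
    rw [← Real.exp_eq_exp_ℝ, mul_right_comm, ← Real.exp_add, neg_add_cancel, Real.exp_zero,
      one_mul] at h
    refine h.congr_fun fun n ↦ ?_
    have hfac : ((n + k).factorial : ℝ) = n.factorial * ((n + k).descFactorial k : ℝ) := by
      have h := Nat.factorial_mul_descFactorial (Nat.le_add_left k n)
      rw [Nat.add_sub_cancel] at h
      exact_mod_cast h.symm
    have hpos : ((n + k).descFactorial k : ℝ) ≠ 0 := by
      simp [Nat.descFactorial_eq_zero_iff_lt]
    simp only [Function.comp_apply, poissonP, hfac]
    field_simp
    ring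
  · intro n hn
    have hlt : n < k := by
      by_contra! hk
      exact hn ⟨n - k, Nat.sub_add_cancel hk⟩
    simp [Nat.descFactorial_eq_zero_iff_lt.2 hlt]

lemma cast_descFactorial_succ (n k : ℕ) :
    (n.descFactorial (k + 1) : ℝ) = (n - k) * (n.descFactorial k : ℝ) := by
  rw [← descPochhammer_eval_eq_descFactorial, ← descPochhammer_eval_eq_descFactorial,
    descPochhammer_succ_eval, mul_comm]

/-- The mean of `(X - a)² - X` for `X ∼ Poisson(lam)`. -/
lemma hasSum_poissonP_mul_sq_sub (lam a : ℝ) :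
    HasSum (fun n : ℕ ↦ poissonP lam n * (((n : ℝ) - a) ^ 2 - n)) ((lam - a) ^ 2) := by
  have h := hasSum_poissonP_mul_descFactorial lam
  convert! ((h 2).add ((h 1).mul_left (-2 * a))).add ((h 0).mul_left (a ^ 2)) using 1
  · ext n
    simp only [cast_descFactorial_succ, Nat.descFactorial_zero]
    push_cast
    ring
  · ring

/-- The second moment of `(X - a)² - X` for `X ∼ Poisson(lam)`. -/
lemma hasSum_poissonP_mul_sq_sub_sq (lam a : ℝ) :
    HasSum (fun n : ℕ ↦ poissonP lam n * (((n : ℝ) - a) ^ 2 - n) ^ 2)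
      ((lam - a) ^ 4 + 4 * lam * (lam - a) ^ 2 + 2 * lam ^ 2) := by
  have h := hasSum_poissonP_mul_descFactorial lam
  convert! ((((h 4).add ((h 3).mul_left (4 - 4 * a))).add
    ((h 2).mul_left (2 + 6 * a ^ 2 - 8 * a))).add
    ((h 1).mul_left (4 * a ^ 2 - 4 * a ^ 3))).add ((h 0).mul_left (a ^ 4)) using 1
  · ext n
    simp only [cast_descFactorial_succ, Nat.descFactorial_zero]
    push_cast
    ring
  · ring

lemma memLp_two_sq_sub_poissonMeasure (lam : NNReal) (a : ℝ) :
    MemLp (fun n : ℕ ↦ ((n : ℝ) - a) ^ 2 - n) 2 (poissonMeasure lam) := by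
  rw [memLp_two_iff_integrable_sq (by fun_prop), integrable_poissonMeasure_iff]
  refine (hasSum_poissonP_mul_sq_sub_sq lam a).summable.congr fun n ↦ ?_
  rw [Real.norm_of_nonneg (sq_nonneg _), poissonP]

lemma integral_sq_sub_poissonMeasure (lam : NNReal) (a : ℝ) :
    ∫ n : ℕ, (((n : ℝ) - a) ^ 2 - n) ∂poissonMeasure lam = (lam - a) ^ 2 := by
  rw [integral_poissonMeasure]
  exact (hasSum_poissonP_mul_sq_sub lam a).tsum_eq

lemma variance_sq_sub_poissonMeasure (lam : NNReal) (a : ℝ) :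
    Var[fun n : ℕ ↦ ((n : ℝ) - a) ^ 2 - n; poissonMeasure lam] =
      4 * lam * (lam - a) ^ 2 + 2 * lam ^ 2 := by
  rw [variance_eq_sub (memLp_two_sq_sub_poissonMeasure lam a), integral_sq_sub_poissonMeasure,
    integral_poissonMeasure]
  simp only [Pi.pow_apply, smul_eq_mul]
  have h := (hasSum_poissonP_mul_sq_sub_sq lam a).tsum_eq
  simp only [poissonP] at h
  rw [h]
  ring

lemma integral_pi_poissonMeasure {ι : Type*} [Fintype ι] (lam : ι → NNReal) {f : (ι → ℕ) → ℝ}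
    (hf : Integrable f (Measure.pi fun i ↦ poissonMeasure (lam i))) :
    ∫ x, f x ∂Measure.pi (fun i ↦ poissonMeasure (lam i)) =
      ∑' x, (∏ i, poissonP (lam i) (x i)) * f x := by
  rw [integral_countable hf]
  refine tsum_congr fun x ↦ ?_
  rw [measureReal_def, Measure.pi_singleton, ENNReal.toReal_prod, smul_eq_mul]
  congr 1
  exact Finset.prod_congr rfl fun i _ ↦ poissonMeasure_real_singleton (lam i) (x i)

/-- Mean and variance of the statistic `Z = Σᵢ ((Xᵢ - m·q(i))² - Xᵢ)` where the `Xᵢ` are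
independent with `Xᵢ ∼ Poisson(m·P(i))`:
`E[Z] = m²·Σᵢ (P(i) - q(i))²` and
`Var[Z] = Σᵢ (4m³(P(i) - q(i))²P(i) + 2m²P(i)²)`. -/
theorem poisson_statistic_mean_variance
    (r : ℕ) (hr : 1 ≤ r) (m : ℝ) (hm : 0 < m)
    (P q : Fin r → ℝ) (hP0 : ∀ i, 0 ≤ P i) (hP1 : ∑ i, P i = 1) :
    (∑' x : Fin r → ℕ,
        (∏ i, poissonP (m * P i) (x i)) *
          (∑ i, (((x i : ℝ) - m * q i) ^ 2 - (x i : ℝ)))) =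
      m ^ 2 * ∑ i, (P i - q i) ^ 2 ∧
    (∑' x : Fin r → ℕ,
        (∏ i, poissonP (m * P i) (x i)) *
          ((∑ i, (((x i : ℝ) - m * q i) ^ 2 - (x i : ℝ))) -
            m ^ 2 * ∑ i, (P i - q i) ^ 2) ^ 2) =
      ∑ i, (4 * m ^ 3 * (P i - q i) ^ 2 * P i + 2 * m ^ 2 * P i ^ 2) := by
  set lam : Fin r → NNReal := fun i ↦ ⟨m * P i, mul_nonneg hm.le (hP0 i)⟩ with hlam
  have hcoe : ∀ i, (lam i : ℝ) = m * P i := fun _ ↦ rfl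
  simp only [← hcoe]
  set μ : Measure (Fin r → ℕ) := Measure.pi fun i ↦ poissonMeasure (lam i) with hμ
  set Y : Fin r → ℕ → ℝ := fun i n ↦ ((n : ℝ) - m * q i) ^ 2 - n with hY
  have hYL : ∀ i, MemLp (Y i) 2 (poissonMeasure (lam i)) := fun i ↦
    memLp_two_sq_sub_poissonMeasure _ _
  have hYpi : ∀ i, MemLp (fun x : Fin r → ℕ ↦ Y i (x i)) 2 μ := fun i ↦
    (hYL i).comp_measurePreserving (measurePreserving_eval _ i)
  have hZ : MemLp (fun x : Fin r → ℕ ↦ ∑ i, Y i (x i)) 2 μ :=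
    memLp_finsetSum _ fun i _ ↦ hYpi i
  have hmean : ∫ x, ∑ i, Y i (x i) ∂μ = m ^ 2 * ∑ i, (P i - q i) ^ 2 := by
    rw [integral_finsetSum _ fun i _ ↦ (hYpi i).integrable one_le_two, Finset.mul_sum]
    refine Finset.sum_congr rfl fun i _ ↦ ?_
    rw [hμ, integral_comp_eval (hYL i).aestronglyMeasurable, integral_sq_sub_poissonMeasure, hcoe]
    ring
  have hvar : Var[fun x : Fin r → ℕ ↦ ∑ i, Y i (x i); μ] =
      ∑ i, (4 * m ^ 3 * (P i - q i) ^ 2 * P i + 2 * m ^ 2 * P i ^ 2) := by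
    rw [← Finset.sum_fn, hμ, variance_sum_pi hYL]
    refine Finset.sum_congr rfl fun i _ ↦ ?_
    rw [variance_sq_sub_poissonMeasure, hcoe]
    ring
  constructor
  · rw [← hmean, hμ, integral_pi_poissonMeasure lam (hZ.integrable one_le_two)]
  · rw [← hvar, variance_eq_integral hZ.aemeasurable, hmean]
    exact (integral_pi_poissonMeasure lam (hZ.sub (memLp_const _)).integrable_sq).symm

end Stmt10
end

section
/- There is an absolute constant C > 0 such that the following holds. Let P be a unimodal probability distribution on ℤ with maximum probability P_max = max_j P(j). Then for every integer M ≥ 2 and every integer ξ with 1 ≤ |ξ| ≤ M/2, the DFT modulo M of P satisfies |P̂(ξ)| ≤ C·P_max·M/|ξ|. -/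
open scoped BigOperators

namespace Stmt15

/-- A (discrete) probability distribution on `α`, given by its probability mass function. -/
def IsDistr {α : Type*} (P : α → ℝ) : Prop :=
  (∀ a, 0 ≤ P a) ∧ HasSum P 1

/-- `P` is unimodal with mode `m₀`: nondecreasing up to `m₀` and nonincreasing after. -/
def IsUnimodalAt (P : ℤ → ℝ) (m₀ : ℤ) : Prop :=
  (∀ i j : ℤ, i ≤ j → j ≤ m₀ → P i ≤ P j) ∧
  (∀ i j : ℤ, m₀ ≤ i → i ≤ j → P j ≤ P i)

/-- The discrete Fourier transform modulo `M` of a distribution on `ℤ`. -/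
noncomputable def dftZ (M : ℕ) (P : ℤ → ℝ) (ξ : ℤ) : ℂ :=
  ∑' j : ℤ, (P j : ℂ) *
    Complex.exp (-(2 * (Real.pi : ℂ) * Complex.I * (ξ : ℂ) * (j : ℂ)) / (M : ℂ))

theorem IsUnimodalAt.hasSum_abs_sub {P : ℤ → ℝ} {m : ℤ} (h : IsUnimodalAt P m)
    (hP : Summable P) : HasSum (fun j => |P j - P (j - 1)|) (2 * P m) := by
  set σ : ℤ → ℝ := fun j => if j ≤ m then 1 else -1 with hσ
  have hs : Summable fun j => σ j * P j := by
    refine Summable.of_norm_bounded hP.norm fun j => ?_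
    simp only [hσ]
    split_ifs <;> simp
  have hs' : Summable fun j => σ (j + 1) * P j := by
    refine Summable.of_norm_bounded hP.norm fun j => ?_
    simp only [hσ]
    split_ifs <;> simp
  have hshift : HasSum (fun j => σ j * P (j - 1)) (∑' j, σ (j + 1) * P j) := by
    rw [← (Equiv.addRight (1 : ℤ)).hasSum_iff]
    simpa [Function.comp_def] using hs'.hasSum
  have hjump : ∑' j, (σ j * P j - σ (j + 1) * P j) = 2 * P m := by
    rw [tsum_eq_single m fun j hj => ?_]
    · simp only [hσ, le_refl, if_true, if_neg (show ¬ m + 1 ≤ m by lia)]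
      ring
    · rcases lt_or_gt_of_ne hj with hj | hj
      · simp only [hσ, if_pos hj.le, if_pos (show j + 1 ≤ m by lia), sub_self]
      · simp only [hσ, if_neg (show ¬ j ≤ m by lia), if_neg (show ¬ j + 1 ≤ m by lia), sub_self]
  rw [hs.tsum_sub hs'] at hjump
  rw [← hjump]
  refine (hs.hasSum.sub hshift).congr_fun fun j => ?_
  by_cases hj : j ≤ m
  · have := h.1 (j - 1) j (by lia) hj
    simp [hσ, hj, abs_of_nonneg (sub_nonneg.2 this)]
  · have := h.2 (j - 1) j (by lia) (by lia)
    simp only [hσ, if_neg hj, abs_of_nonpos (sub_nonpos.2 this)]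
    ring

/-- The total variation of a unimodal sequence bounds its Fourier series. -/
theorem IsUnimodalAt.norm_one_sub_mul_tsum_le {P : ℤ → ℝ} {m : ℤ} (h : IsUnimodalAt P m)
    (hP : Summable P) {w : ℂ} (hw : ‖w‖ = 1) :
    ‖1 - w‖ * ‖∑' j : ℤ, (P j : ℂ) * w ^ j‖ ≤ 2 * P m := by
  have hw0 : w ≠ 0 := by
    rintro rfl
    simp at hw
  have hs : Summable fun j : ℤ => (P j : ℂ) * w ^ j :=
    Summable.of_norm_bounded hP.norm fun j => by simp [hw]
  have hshift : HasSum (fun j : ℤ => (P (j - 1) : ℂ) * w ^ j) (w * ∑' j : ℤ, (P j : ℂ) * w ^ j) := by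
    rw [← (Equiv.addRight (1 : ℤ)).hasSum_iff]
    refine (hs.hasSum.mul_left w).congr_fun fun j => ?_
    simp only [Function.comp_apply, Equiv.coe_addRight, add_sub_cancel_right, zpow_add_one₀ hw0]
    ring
  rw [← norm_mul, sub_mul, one_mul, ← (hs.hasSum.sub hshift).tsum_eq]
  refine tsum_of_norm_bounded (h.hasSum_abs_sub hP) fun j => ?_
  rw [← sub_mul, norm_mul, norm_zpow, hw, one_zpow, mul_one, ← Complex.ofReal_sub,
    Complex.norm_real, Real.norm_eq_abs]

theorem two_div_pi_mul_abs_le_norm_one_sub_exp {x : ℝ} (hx : |x| ≤ Real.pi) :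
    2 / Real.pi * |x| ≤ ‖1 - Complex.exp (Complex.I * x)‖ := by
  have h := Real.mul_abs_le_abs_sin (x := x / 2) (by rw [abs_div, abs_two]; linarith)
  rw [abs_div, abs_two] at h
  rw [norm_sub_rev, Complex.norm_exp_I_mul_ofReal_sub_one, norm_mul, Real.norm_eq_abs,
    Real.norm_eq_abs, abs_two]
  linarith

/-- Fourier decay for unimodal distributions: if `P` is unimodal with maximum probability
`P_max`, then `|P̂(ξ)| ≤ C·P_max·M/|ξ|` for `1 ≤ |ξ| ≤ M/2`. -/
theorem unimodal_fourier_decay :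
    ∃ C : ℝ, 0 < C ∧
      ∀ P : ℤ → ℝ, IsDistr P → (∃ m₀ : ℤ, IsUnimodalAt P m₀) →
        ∀ Pmax : ℝ, IsGreatest (Set.range P) Pmax →
          ∀ M : ℕ, 2 ≤ M → ∀ ξ : ℤ, 1 ≤ |ξ| → (|ξ| : ℝ) ≤ (M : ℝ) / 2 →
            ‖dftZ M P ξ‖ ≤ C * Pmax * (M : ℝ) / (|ξ| : ℝ) := by
  refine ⟨1, one_pos, fun P hP ⟨m, hm⟩ Pmax hmax M hM ξ hξ hξM => ?_⟩
  have hM0 : (0 : ℝ) < M := by exact_mod_cast (by lia : 0 < M)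
  have hξ0 : (0 : ℝ) < |(ξ : ℝ)| := by exact_mod_cast (by lia : 0 < |ξ|)
  set x : ℝ := -(2 * Real.pi * ξ / M) with hx
  have habs : |x| = 2 * Real.pi * |(ξ : ℝ)| / M := by
    rw [hx, abs_neg, abs_div, abs_mul, abs_of_pos Real.two_pi_pos, abs_of_pos hM0]
  have hxpi : |x| ≤ Real.pi := by
    rw [habs, div_le_iff₀ hM0]
    nlinarith [Real.pi_pos]
  have hdft : dftZ M P ξ = ∑' j : ℤ, (P j : ℂ) * Complex.exp (Complex.I * x) ^ j := by
    refine tsum_congr fun j => ?_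
    rw [← Complex.exp_int_mul, hx]
    congr 2
    push_cast
    ring
  have hw : ‖Complex.exp (Complex.I * x)‖ = 1 := Complex.norm_exp_I_mul_ofReal x
  have hdecay := hm.norm_one_sub_mul_tsum_le hP.2.summable hw
  rw [← hdft] at hdecay
  have hlow := two_div_pi_mul_abs_le_norm_one_sub_exp hxpi
  have hlow' : 4 * |(ξ : ℝ)| / M ≤ ‖1 - Complex.exp (Complex.I * x)‖ := by
    refine le_of_eq_of_le ?_ hlow
    rw [habs]
    field_simp
    ring
  have hle : 4 * |(ξ : ℝ)| / M * ‖dftZ M P ξ‖ ≤ 2 * Pmax :=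
    (mul_le_mul_of_nonneg_right hlow' (norm_nonneg _)).trans
      (hdecay.trans (by linarith [hmax.2 ⟨m, rfl⟩]))
  rw [div_mul_eq_mul_div, div_le_iff₀ hM0] at hle
  rw [le_div_iff₀ hξ0]
  nlinarith [norm_nonneg (dftZ M P ξ)]

end Stmt15
end
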